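/- Let M ⊂ ℂ^N be a smooth real hypersurface which is holomorphically nondegenerate at p₀ ∈ M. Then there exist an open neighborhood U of p₀ in M and a dense open subset U′ ⊆ U such that M is finitely nondegenerate of order at most N − 1 at every p ∈ U′: for every p ∈ U′, Span_ℂ{ (L^ᾱ ρ_z)(p) : α ∈ ℤ₊^n, |α| ≤ N − 1 } = ℂ^N. -/

import Mathlib

open scoped Topology

noncomputable section

/-- Points of `ℂ^N`. -/
abbrev CPt (N : ℕ) := Fin N → ℂ

/-- The Wirtinger derivative `∂u/∂z_m = (1/2)(∂u/∂x_m − i ∂u/∂y_m)`. -/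
noncomputable def wz {N : ℕ} (m : Fin N) (u : CPt N → ℂ) (z : CPt N) : ℂ :=
  (1 / 2) * (fderiv ℝ u z (Pi.single m 1) - Complex.I * fderiv ℝ u z (Pi.single m Complex.I))

/-- The Wirtinger derivative `∂u/∂z̄_m = (1/2)(∂u/∂x_m + i ∂u/∂y_m)`. -/
noncomputable def wzb {N : ℕ} (m : Fin N) (u : CPt N → ℂ) (z : CPt N) : ℂ :=
  (1 / 2) * (fderiv ℝ u z (Pi.single m 1) + Complex.I * fderiv ℝ u z (Pi.single m Complex.I))

/-- `ρ` is a local defining function of `M` near `p`: smooth, real valued, with nonvanishing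
differential, and `M ∩ U = {ρ = 0} ∩ U`. -/
def DefiningFn (N : ℕ) (M : Set (CPt N)) (U : Set (CPt N)) (ρ : CPt N → ℝ) (p : CPt N) :
    Prop :=
  IsOpen U ∧ p ∈ U ∧ ContDiffOn ℝ (⊤ : ℕ∞) ρ U ∧
    (M ∩ U = {z | z ∈ U ∧ ρ z = 0}) ∧ ∀ z ∈ U, fderiv ℝ ρ z ≠ 0

/-- `M` is a smooth real hypersurface of `ℂ^N`. -/
def IsHypersurface (N : ℕ) (M : Set (CPt N)) : Prop :=
  ∀ p ∈ M, ∃ U ρ, DefiningFn N M U ρ p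

/-- `a` is (the coefficient matrix of) a basis `L_j̄ = Σ_m a_{jm} ∂/∂z̄_m` of the CR vector
fields of `M` on `U`: smooth coefficients, tangency `Σ_m a_{jm} ∂ρ/∂z̄_m = 0` on `M ∩ U`, and
pointwise linear independence. -/
def CRBasisOn (N n : ℕ) (M : Set (CPt N)) (U : Set (CPt N)) (ρ : CPt N → ℝ)
    (a : Fin n → Fin N → CPt N → ℂ) : Prop :=
  (∀ j m, ContDiffOn ℝ (⊤ : ℕ∞) (a j m) U) ∧
  (∀ j, ∀ z ∈ M ∩ U, (∑ m, a j m z * wzb m (fun w => ((ρ w : ℝ) : ℂ)) z) = 0) ∧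
  (∀ z ∈ M ∩ U, LinearIndependent ℂ fun j : Fin n => fun m => a j m z)

/-- The CR operator `L_j̄ = Σ_m a_{jm} ∂/∂z̄_m` acting on functions. -/
noncomputable def crOp {N n : ℕ} (a : Fin n → Fin N → CPt N → ℂ) (j : Fin n)
    (u : CPt N → ℂ) : CPt N → ℂ :=
  fun z => ∑ m, a j m z * wzb m u z

/-- The iterated CR operator `L^ᾱ = L_1̄^{α₁} ⋯ L_n̄^{α_n}`. -/
noncomputable def crPow {N n : ℕ} (a : Fin n → Fin N → CPt N → ℂ) (α : Fin n → ℕ)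
    (u : CPt N → ℂ) : CPt N → ℂ :=
  ((List.finRange n).foldr (fun j F => (crOp a j)^[α j] ∘ F) id) u

/-- The span condition `Span_ℂ{(L^ᾱ ρ_z)(p) : |α| ≤ k} = ℂ^N`. -/
def SpanCondAt (N n : ℕ) (ρ : CPt N → ℝ) (a : Fin n → Fin N → CPt N → ℂ) (k : ℕ)
    (p : CPt N) : Prop :=
  Submodule.span ℂ {v : CPt N | ∃ α : Fin n → ℕ, (∑ j, α j) ≤ k ∧
    v = fun l => crPow a α (wz l fun w => ((ρ w : ℝ) : ℂ)) p} = ⊤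

/-- `M` is `k₀`-nondegenerate at `p`: for some (equivalently, any) local defining function
and basis of CR vector fields near `p`, `k₀` is the smallest integer with
`Span_ℂ{(L^ᾱ ρ_z)(p) : |α| ≤ k₀} = ℂ^N`. -/
def KNondegenerateAt (N k₀ : ℕ) (M : Set (CPt N)) (p : CPt N) : Prop :=
  ∃ U ρ a, DefiningFn N M U ρ p ∧ CRBasisOn N (N - 1) M U ρ a ∧
    SpanCondAt N (N - 1) ρ a k₀ p ∧ ∀ j < k₀, ¬SpanCondAt N (N - 1) ρ a j p

attribute [local instance] Classical.propDecidable

/-- The iterated Wirtinger derivative `∂_z^α ∂_z̄^β u`. -/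
noncomputable def wpow {N : ℕ} (α β : Fin N → ℕ) (u : CPt N → ℂ) : CPt N → ℂ :=
  ((List.finRange N).foldr (fun m F => (wz m)^[α m] ∘ F) id)
    (((List.finRange N).foldr (fun m F => (wzb m)^[β m] ∘ F) id) u)

/-- The complexified formal Taylor series of `u` at `p`, as a formal power series in
`(z − p, z̄ − p̄)`: the coefficient of `(z−p)^α (z̄−p̄)^β` is `∂_z^α ∂_z̄^β u(p)/(α! β!)`. -/
noncomputable def cTaylor {N : ℕ} (u : CPt N → ℂ) (p : CPt N) :
    MvPowerSeries (Fin N ⊕ Fin N) ℂ :=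
  fun μ => wpow (fun m => μ (Sum.inl m)) (fun m => μ (Sum.inr m)) u p /
    (((∏ m, Nat.factorial (μ (Sum.inl m))) * ∏ m, Nat.factorial (μ (Sum.inr m)) : ℕ) : ℂ)

/-- The embedding `ℂ[[z − p]] → ℂ[[z − p, z̄ − p̄]]`. -/
noncomputable def embZ {N : ℕ} (a : MvPowerSeries (Fin N) ℂ) :
    MvPowerSeries (Fin N ⊕ Fin N) ℂ :=
  fun μ => if _h : ∀ m, μ (Sum.inr m) = 0
    then MvPowerSeries.coeff
      (Finsupp.comapDomain Sum.inl μ Sum.inl_injective.injOn) a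
    else 0

/-- `M` is (formally) holomorphically degenerate at `p`: for a local defining function `ρ`
there are formal power series `a₁,…,a_N ∈ ℂ[[z−p]]`, not all zero, such that `ρ̂` divides
`Σ_j a_j·(∂ρ/∂z_j)^` in `ℂ[[z−p, z̄−p̄]]`. -/
def HoloDegenerateAt (N : ℕ) (M : Set (CPt N)) (p : CPt N) : Prop :=
  ∃ U ρ, DefiningFn N M U ρ p ∧
    ∃ a : Fin N → MvPowerSeries (Fin N) ℂ, (∃ j, a j ≠ 0) ∧
      cTaylor (fun w => ((ρ w : ℝ) : ℂ)) p ∣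
        ∑ j, embZ (a j) * cTaylor (wz j fun w => ((ρ w : ℝ) : ℂ)) p

/-- `M` is finitely nondegenerate of order at most `k` at `p`: for some local defining
function and basis of CR vector fields near `p`,
`Span_ℂ{(L^ᾱ ρ_z)(p) : |α| ≤ k} = ℂ^N`. -/
def FinNondegOrderLe (N k : ℕ) (M : Set (CPt N)) (p : CPt N) : Prop :=
  ∃ U ρ a, DefiningFn N M U ρ p ∧ CRBasisOn N (N - 1) M U ρ a ∧ SpanCondAt N (N - 1) ρ a k p

section

open MvPowerSeries

/-- The multi-index power `f^μ`, composed in the order of the list `l`. -/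
def dpow {A ι : Type*} (f : ι → A → A) (l : List ι) (μ : ι → ℕ) : A → A :=
  l.foldr (fun i F => (f i)^[μ i] ∘ F) id

section Dpow

variable {A B ι : Type*} {f : ι → A → A}

theorem dpow_cons (i : ι) (l : List ι) (μ : ι → ℕ) (u : A) :
    dpow f (i :: l) μ u = (f i)^[μ i] (dpow f l μ u) := rfl

theorem dpow_append (l l' : List ι) (μ : ι → ℕ) (u : A) :
    dpow f (l ++ l') μ u = dpow f l μ (dpow f l' μ u) := by
  induction l with
  | nil => rfl
  | cons i l ih => simp only [List.cons_append, dpow_cons, ih]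

theorem dpow_map {κ : Type*} (g : κ → ι) (l : List κ) (μ : ι → ℕ) (u : A) :
    dpow f (l.map g) μ u = dpow (fun k => f (g k)) l (fun k => μ (g k)) u := by
  induction l with
  | nil => rfl
  | cons i l ih => simp only [List.map_cons, dpow_cons, ih]

theorem dpow_zero (l : List ι) (u : A) : dpow f l 0 u = u := by
  induction l with
  | nil => rfl
  | cons i l ih => simp [dpow_cons, ih]

/-- Relations preserved by all generators are preserved by their multi-index powers. -/
theorem dpow_rel {g : ι → B → B} {R : A → B → Prop}
    (h : ∀ i u v, R u v → R (f i u) (g i v)) (l : List ι) (μ : ι → ℕ) {u : A} {v : B}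
    (huv : R u v) : R (dpow f l μ u) (dpow g l μ v) := by
  induction l with
  | nil => exact huv
  | cons i l ih =>
    simp only [dpow_cons]
    generalize μ i = k
    induction k with
    | zero => exact ih
    | succ k ihk => simpa only [Function.iterate_succ_apply'] using h _ _ _ ihk

theorem dpow_semiconj {g : ι → B → B} (φ : A → B) (h : ∀ i u, φ (f i u) = g i (φ u))
    (l : List ι) (μ : ι → ℕ) (u : A) : φ (dpow f l μ u) = dpow g l μ (φ u) :=
  dpow_rel (R := fun u v => φ u = v) (fun i u v huv => by rw [h, huv]) l μ rfl

theorem dpow_induction {Q : A → Prop} (h : ∀ i u, Q u → Q (f i u)) (l : List ι) (μ : ι → ℕ)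
    {u : A} (hu : Q u) : Q (dpow f l μ u) :=
  dpow_rel (g := f) (R := fun u _ => Q u) (fun i u _ hu => h i u hu) l μ (v := u) hu

theorem dpow_congr_index {l : List ι} {μ ν : ι → ℕ} (h : ∀ i ∈ l, μ i = ν i) (u : A) :
    dpow f l μ u = dpow f l ν u := by
  induction l with
  | nil => rfl
  | cons i l ih =>
    rw [dpow_cons, dpow_cons, h i (by simp), ih fun j hj => h j (by simp [hj])]

theorem dpow_add_single [DecidableEq ι] (hf : ∀ i j u, f i (f j u) = f j (f i u)) {l : List ι}
    (hl : l.Nodup) {i : ι} (hi : i ∈ l) (μ : ι → ℕ) (u : A) :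
    dpow f l (μ + Pi.single i 1) u = f i (dpow f l μ u) := by
  induction l with
  | nil => simp at hi
  | cons j l ih =>
    rw [List.nodup_cons] at hl
    simp only [dpow_cons]
    by_cases hij : i = j
    · subst hij
      rw [dpow_congr_index (ν := μ)]
      · simp [Function.iterate_succ_apply']
      · intro k hk
        have : k ≠ i := fun h => hl.1 (h ▸ hk)
        simp [this]
    · have hj : j ≠ i := fun h => hij h.symm
      rw [ih hl.2 (by simpa [hij] using hi)]
      have hc : Function.Commute (f j) (f i) := fun u => hf j i u
      simpa [hj] using (hc.iterate_left (μ j)) (dpow f l μ u)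

end Dpow

section Taylor

variable {A ι : Type*} [CommRing A] [Algebra ℂ A]

/-- A family of power series closed under partial derivatives and without constant terms
consists of zero only. -/
theorem MvPowerSeries.eq_zero_of_pderiv_stable {Q : MvPowerSeries ι ℂ → Prop}
    (h0 : ∀ f, Q f → constantCoeff f = 0) (hd : ∀ i f, Q f → Q (pderiv ℂ i f))
    {f : MvPowerSeries ι ℂ} (hf : Q f) : f = 0 := by
  ext μ
  rw [map_zero]
  induction hk : μ.degree generalizing μ f with
  | zero =>
    rw [(Finsupp.degree_eq_zero_iff μ).1 hk, coeff_zero_eq_constantCoeff_apply]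
    exact h0 f hf
  | succ k ih =>
    have hμ : μ ≠ 0 := by rintro rfl; simp at hk
    obtain ⟨i, hi⟩ := Finsupp.ne_iff.1 hμ
    have hle : Finsupp.single i 1 ≤ μ := by
      simpa [Nat.one_le_iff_ne_zero] using hi
    obtain ⟨ν, rfl⟩ := exists_add_of_le hle
    have h := ih (hd i f hf) ν (by simp at hk; omega)
    rw [coeff_pderiv, mul_eq_zero, add_comm ν] at h
    exact h.resolve_right (Nat.cast_add_one_ne_zero _)

variable (D : ι → Derivation ℂ A A) (ev : A →ₐ[ℂ] ℂ) (l : List ι)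

theorem dpow_derivation_add (μ : ι → ℕ) (u v : A) :
    dpow (fun i => D i) l μ (u + v) = dpow (fun i => D i) l μ u + dpow (fun i => D i) l μ v := by
  have := dpow_rel (f := fun i => D i) (g := fun i => Prod.map (D i) (D i))
    (R := fun a b => a = b.1 + b.2) (by rintro i _ ⟨a, b⟩ rfl; simp) l μ
    (u := u + v) (v := (u, v)) rfl
  rw [this, dpow_semiconj (g := fun i => D i) Prod.fst (fun _ _ => rfl),
    dpow_semiconj (g := fun i => D i) Prod.snd (fun _ _ => rfl)]

variable [Fintype ι]

/-- The Taylor series of `u` along the vector fields `D i`, at the point given by `ev`. -/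
def taylorFun (u : A) : MvPowerSeries ι ℂ :=
  fun μ => ev (dpow (fun i => D i) l μ u) / ((∏ i, (μ i).factorial : ℕ) : ℂ)

theorem coeff_taylorFun (u : A) (μ : ι →₀ ℕ) : coeff μ (taylorFun D ev l u) =
    ev (dpow (fun i => D i) l μ u) / ((∏ i, (μ i).factorial : ℕ) : ℂ) := rfl

theorem constantCoeff_taylorFun (u : A) : constantCoeff (taylorFun D ev l u) = ev u := by
  rw [← coeff_zero_eq_constantCoeff_apply, coeff_taylorFun, Finsupp.coe_zero, dpow_zero]
  simp

variable {D l}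

theorem pderiv_taylorFun (hD : ∀ i j u, D i (D j u) = D j (D i u)) (hl : l.Nodup)
    (hl' : ∀ i, i ∈ l) (i : ι) (u : A) :
    pderiv ℂ i (taylorFun D ev l u) = taylorFun D ev l (D i u) := by
  classical
  ext μ
  rw [coeff_pderiv, coeff_taylorFun, coeff_taylorFun, Finsupp.coe_add, Finsupp.single_eq_pi_single,
    dpow_add_single (f := fun i => D i) hD hl (hl' i),
    dpow_semiconj (f := fun i => D i) (g := fun i => D i) (D i) (fun j u => hD i j u)]
  have h1 : ∏ k, ((⇑μ + Pi.single i 1 : ι → ℕ) k).factorial =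
      (μ i + 1) * ∏ k, (μ k).factorial := by
    rw [← Finset.mul_prod_erase _ _ (Finset.mem_univ i),
      ← Finset.mul_prod_erase _ (fun k => (μ k).factorial) (Finset.mem_univ i), ← mul_assoc]
    congr 1
    · simp [Nat.factorial_succ]
    · refine Finset.prod_congr rfl fun k hk => ?_
      simp [(Finset.mem_erase.1 hk).1]
  rw [h1]
  have h2 : ((∏ k, (μ k).factorial : ℕ) : ℂ) ≠ 0 := by
    exact_mod_cast Finset.prod_ne_zero_iff.2 fun k _ => Nat.factorial_ne_zero _
  have h3 : (μ i : ℂ) + 1 ≠ 0 := Nat.cast_add_one_ne_zero _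
  push_cast at h2 ⊢
  field_simp

theorem taylorFun_add (u v : A) :
    taylorFun D ev l (u + v) = taylorFun D ev l u + taylorFun D ev l v := by
  ext μ
  rw [map_add, coeff_taylorFun, coeff_taylorFun, coeff_taylorFun, dpow_derivation_add, map_add,
    add_div]

variable (hD : ∀ i j u, D i (D j u) = D j (D i u)) (hl : l.Nodup) (hl' : ∀ i, i ∈ l)

/-- The Taylor expansion along commuting derivations, as a ring homomorphism. -/
def taylorHom : A →+* MvPowerSeries ι ℂ :=
  let T : A →+ MvPowerSeries ι ℂ := AddMonoidHom.mk' (taylorFun D ev l) (taylorFun_add ev)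
  have hT : ∀ i u, pderiv ℂ i (T u) = T (D i u) := pderiv_taylorFun ev hD hl hl'
  have hc : ∀ u, constantCoeff (T u) = ev u := constantCoeff_taylorFun D ev l
  { T with
    map_one' := by
      refine pderiv.ext (fun i => ?_) ?_
      · exact (hT i 1).trans (by simp)
      · exact (hc 1).trans (by simp)
    map_mul' := fun u v => by
      refine sub_eq_zero.1 (eq_zero_of_pderiv_stable (Q := fun f => f ∈ AddSubgroup.closure
        {g | ∃ u v : A, g = T (u * v) - T u * T v}) ?_ ?_
          (AddSubgroup.subset_closure ⟨u, v, rfl⟩))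
      · intro f hf
        induction hf using AddSubgroup.closure_induction with
        | mem x hx => obtain ⟨u, v, rfl⟩ := hx; simp [hc]
        | zero => simp
        | add x y _ _ hx hy => simp [hx, hy]
        | neg x _ hx => simp [hx]
      · intro i f hf
        induction hf using AddSubgroup.closure_induction with
        | mem x hx =>
          obtain ⟨u, v, rfl⟩ := hx
          have : pderiv ℂ i (T (u * v) - T u * T v) =
              (T (u * D i v) - T u * T (D i v)) + (T (v * D i u) - T v * T (D i u)) := by
            rw [map_sub, hT, Derivation.leibniz, Derivation.leibniz, hT, hT]
            simp only [smul_eq_mul, map_add]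
            ring
          rw [this]
          exact add_mem (AddSubgroup.subset_closure ⟨_, _, rfl⟩)
            (AddSubgroup.subset_closure ⟨_, _, rfl⟩)
        | zero => simp
        | add x y _ _ hx hy => simpa using add_mem hx hy
        | neg x _ hx => simpa using hx }

theorem coeff_taylorHom (u : A) (μ : ι →₀ ℕ) : coeff μ (taylorHom ev hD hl hl' u) =
    ev (dpow (fun i => D i) l μ u) / ((∏ i, (μ i).factorial : ℕ) : ℂ) := rfl

theorem pderiv_taylorHom (i : ι) (u : A) :
    pderiv ℂ i (taylorHom ev hD hl hl' u) = taylorHom ev hD hl hl' (D i u) :=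
  pderiv_taylorFun ev hD hl hl' i u

theorem constantCoeff_taylorHom (u : A) : constantCoeff (taylorHom ev hD hl hl' u) = ev u :=
  constantCoeff_taylorFun D ev l u

theorem coeff_taylorHom_eq_zero_iff (u : A) (μ : ι →₀ ℕ) :
    coeff μ (taylorHom ev hD hl hl' u) = 0 ↔ ev (dpow (fun i => D i) l μ u) = 0 := by
  rw [coeff_taylorHom, div_eq_zero_iff, or_iff_left]
  exact_mod_cast Finset.prod_ne_zero_iff.2 fun k _ => Nat.factorial_ne_zero _

end Taylor

section Tangential

variable {A ι : Type*} [CommRing A] [Algebra ℂ A] (D : ι → Derivation ℂ A A)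

/-- The derivations `D i - (D i ρ / D τ ρ) D τ`, which annihilate `ρ`; here `e` plays the role of
`1 / D τ ρ`. -/
def tang (e ρ : A) (τ i : ι) : Derivation ℂ A A := D i - (e * D i ρ) • D τ

variable {D} {e ρ : A} {τ : ι}

theorem tang_apply (i : ι) (u : A) : tang D e ρ τ i u = D i u - e * D i ρ * D τ u := by
  simp [tang]

theorem tang_self (he : ∀ i u, e * D τ ρ * D i u = D i u) (i : ι) : tang D e ρ τ i ρ = 0 := by
  rw [tang_apply]
  linear_combination -he i ρ

theorem tang_pivot (he : ∀ i u, e * D τ ρ * D i u = D i u) (u : A) : tang D e ρ τ τ u = 0 := by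
  rw [tang_apply, he, sub_self]

theorem tang_comm (he : ∀ i u, e * D τ ρ * D i u = D i u)
    (hD : ∀ i j u, D i (D j u) = D j (D i u)) (i j : ι) (u : A) :
    tang D e ρ τ i (tang D e ρ τ j u) = tang D e ρ τ j (tang D e ρ τ i u) := by
  have key : ∀ u, tang D e ρ τ i (tang D e ρ τ j u) - tang D e ρ τ j (tang D e ρ τ i u) =
      (tang D e ρ τ j (e * D i ρ) - tang D e ρ τ i (e * D j ρ)) * D τ u := by
    intro u
    simp only [tang_apply, map_sub, Derivation.leibniz, smul_eq_mul, hD j i, hD τ i, hD τ j]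
    ring
  have h := key ρ
  rw [tang_self he, tang_self he, map_zero, map_zero, sub_self] at h
  rw [← sub_eq_zero, key, ← he τ u]
  linear_combination -(e * D τ u) * h

end Tangential

section Division

variable {σ : Type*}

/-- The coefficients of the monomials divisible by `X τ`, divided by `X τ`. -/
def shiftVar (τ : σ) : MvPowerSeries σ ℂ →ₗ[ℂ] MvPowerSeries σ ℂ where
  toFun f := fun μ => coeff (μ + Finsupp.single τ 1) f
  map_add' _ _ := rfl
  map_smul' _ _ := rfl

theorem coeff_shiftVar (τ : σ) (f : MvPowerSeries σ ℂ) (μ : σ →₀ ℕ) :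
    coeff μ (shiftVar τ f) = coeff (μ + Finsupp.single τ 1) f := rfl

theorem shiftVar_eq_zero_iff {τ : σ} {f : MvPowerSeries σ ℂ} :
    shiftVar τ f = 0 ↔ pderiv ℂ τ f = 0 := by
  simp only [MvPowerSeries.ext_iff, coeff_shiftVar, coeff_pderiv, map_zero, mul_eq_zero]
  refine forall_congr' fun μ => ⟨Or.inl, fun h => h.resolve_right ?_⟩
  exact Nat.cast_add_one_ne_zero _

theorem shiftVar_X_mul (τ : σ) (f : MvPowerSeries σ ℂ) : shiftVar τ (X τ * f) = f := by
  ext μ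
  rw [coeff_shiftVar, add_comm, X_def, coeff_add_monomial_mul, one_mul]

theorem shiftVar_sub_X_mul (τ : σ) (f : MvPowerSeries σ ℂ) :
    shiftVar τ (f - X τ * shiftVar τ f) = 0 := by
  rw [map_sub, shiftVar_X_mul, sub_self]

theorem shiftVar_mul {τ : σ} {g : MvPowerSeries σ ℂ} (hg : shiftVar τ g = 0)
    (f : MvPowerSeries σ ℂ) : shiftVar τ (g * f) = g * shiftVar τ f := by
  have h : shiftVar τ (g * (f - X τ * shiftVar τ f)) = 0 := by
    rw [shiftVar_eq_zero_iff, Derivation.leibniz, shiftVar_eq_zero_iff.1 hg,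
      shiftVar_eq_zero_iff.1 (shiftVar_sub_X_mul τ f), smul_zero, smul_zero, add_zero]
  rw [mul_sub, map_sub, sub_eq_zero] at h
  rw [h, mul_left_comm, shiftVar_X_mul]

/-- Division by a power series which is regular of order one in the variable `X τ`. -/
theorem exists_eq_mul_add_of_pivot {τ : σ} {ρ : MvPowerSeries σ ℂ} (h0 : constantCoeff ρ = 0)
    (h1 : constantCoeff (pderiv ℂ τ ρ) ≠ 0) (f : MvPowerSeries σ ℂ) :
    ∃ q r, f = q * ρ + r ∧ pderiv ℂ τ r = 0 := by
  classical
  set w : σ → ℕ := fun i => if i = τ then 0 else 1 with hw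
  set u := shiftVar τ ρ with hu
  set ρ₀ := ρ - X τ * u with hρ₀
  have hρ₀S : shiftVar τ ρ₀ = 0 := shiftVar_sub_X_mul τ ρ
  have hu0 : constantCoeff u ≠ 0 := by
    rw [← coeff_zero_eq_constantCoeff_apply, coeff_pderiv] at h1
    rw [← coeff_zero_eq_constantCoeff_apply, hu, coeff_shiftVar]
    simpa using h1
  have huu : u * u⁻¹ = 1 := MvPowerSeries.mul_inv_cancel u hu0
  -- weight zero forces a monomial in `X τ` alone
  have hw0 : ∀ μ : σ →₀ ℕ, Finsupp.weight w μ = 0 → μ = Finsupp.single τ (μ τ) := by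
    intro μ hμ
    ext i
    by_cases hi : i = τ
    · subst hi; simp
    · have := (Finsupp.weight_apply w μ).symm.trans hμ
      rw [Finsupp.sum, Finset.sum_eq_zero_iff] at this
      by_contra hne
      have hne' : μ i ≠ 0 := by
        intro h; apply hne; rw [h]; simp [Ne.symm hi]
      have := this i (Finsupp.mem_support_iff.2 hne')
      simp [hw, hi] at this
      exact hne' this
  have hρ₀w : (1 : ℕ∞) ≤ ρ₀.weightedOrder w := by
    refine nat_le_weightedOrder w (n := 1) fun μ hμ => ?_
    have hμ' := hw0 μ (by omega)
    rcases hk : μ τ with _ | k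
    · rw [hμ', hk, Finsupp.single_zero, coeff_zero_eq_constantCoeff_apply]
      simp [hρ₀, h0]
    · have := congrArg (coeff (Finsupp.single τ k)) hρ₀S
      rw [coeff_shiftVar, ← Finsupp.single_add, map_zero] at this
      rw [hμ', hk, this]
  have hSw : ∀ g : MvPowerSeries σ ℂ, g.weightedOrder w ≤ (shiftVar τ g).weightedOrder w := by
    intro g
    refine le_weightedOrder w fun μ hμ => ?_
    rw [coeff_shiftVar]
    refine coeff_eq_zero_of_lt_weightedOrder w ?_
    rwa [map_add, Finsupp.weight_single, show w τ = 0 by simp [hw], smul_zero, add_zero]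
  let F : MvPowerSeries σ ℂ → MvPowerSeries σ ℂ := fun q => u⁻¹ * (shiftVar τ f - ρ₀ * shiftVar τ q)
  have hF : ∀ (k : ℕ) (q q' : MvPowerSeries σ ℂ), (k : ℕ∞) ≤ (q - q').weightedOrder w →
      ((k + 1 : ℕ) : ℕ∞) ≤ (F q - F q').weightedOrder w := by
    intro k q q' hk
    have : F q - F q' = -(u⁻¹ * (ρ₀ * shiftVar τ (q - q'))) := by
      simp only [F, map_sub]; ring
    rw [this, weightedOrder_neg]
    refine le_trans ?_ (le_weightedOrder_mul w)
    refine le_trans ?_ (le_add_of_nonneg_left (by simp))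
    refine le_trans ?_ (le_weightedOrder_mul w)
    rw [Nat.cast_add, add_comm]
    exact add_le_add (by simpa using hρ₀w) (hk.trans (hSw _))
  have hstep : ∀ k : ℕ, (k : ℕ∞) ≤ (F^[k + 1] 0 - F^[k] 0).weightedOrder w := by
    intro k
    induction k with
    | zero => simp
    | succ k ih => 
      rw [Function.iterate_succ_apply' F (k + 1)]
      nth_rewrite 2 [Function.iterate_succ_apply' F k]
      exact hF k _ _ ih
  have hcauchy : ∀ (k m : ℕ), k ≤ m → (k : ℕ∞) ≤ (F^[m] 0 - F^[k] 0).weightedOrder w := by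
    intro k m hkm
    induction m, hkm using Nat.le_induction with
    | base => simp
    | succ m hkm ih =>
      rw [← sub_add_sub_cancel _ (F^[m] 0)]
      refine le_trans (le_min ?_ ih) (min_weightedOrder_le_add w)
      exact le_trans (by exact_mod_cast hkm) (hstep m)
  let q : MvPowerSeries σ ℂ := fun μ => coeff μ (F^[Finsupp.weight w μ + 1] 0)
  have hq : ∀ k : ℕ, (k : ℕ∞) ≤ (q - F^[k] 0).weightedOrder w := by
    intro k
    refine nat_le_weightedOrder w fun μ hμ => ?_
    have := coeff_eq_zero_of_lt_weightedOrder w (d := μ)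
      (lt_of_lt_of_le (by exact_mod_cast Nat.lt_succ_self _) (hcauchy _ k hμ))
    rw [map_sub, sub_eq_zero] at this ⊢
    exact this.symm
  have hfix : F q = q := by
    ext μ
    have h2 := coeff_eq_zero_of_lt_weightedOrder w (d := μ) (lt_of_lt_of_le
      (by exact_mod_cast (by omega : Finsupp.weight w μ < Finsupp.weight w μ + 1 + 1))
      (hF _ _ _ (hq (Finsupp.weight w μ + 1))))
    rw [← Function.iterate_succ_apply' F] at h2
    have h3 := coeff_eq_zero_of_lt_weightedOrder w (d := μ) (lt_of_lt_of_le
      (by exact_mod_cast (by omega : Finsupp.weight w μ < Finsupp.weight w μ + 1 + 1))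
      (hq (Finsupp.weight w μ + 1 + 1)))
    rw [map_sub, sub_eq_zero] at h2 h3
    rw [h2, h3]
  refine ⟨q, f - q * ρ, by ring, ?_⟩
  rw [← shiftVar_eq_zero_iff, map_sub]
  have hqu : q * u + ρ₀ * shiftVar τ q = shiftVar τ f := by
    have : u * F q = u * q := by rw [hfix]
    simp only [F, ← mul_assoc, huu, one_mul] at this
    linear_combination -this
  have hqρ : q * ρ = ρ₀ * q + X τ * (q * u) := by rw [hρ₀]; ring
  rw [hqρ, map_add, shiftVar_mul hρ₀S, shiftVar_X_mul, ← hqu]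
  ring

theorem pderiv_comm (i j : σ) (f : MvPowerSeries σ ℂ) :
    pderiv ℂ i (pderiv ℂ j f) = pderiv ℂ j (pderiv ℂ i f) := by
  classical
  ext μ
  simp only [coeff_pderiv, add_right_comm μ (Finsupp.single i 1), Finsupp.add_apply,
    Finsupp.single_apply]
  by_cases h : i = j
  · subst h; ring
  · simp [h, Ne.symm h]; ring

/-- The constant coefficient, as an algebra homomorphism. -/
def constantCoeffAlgHom (σ : Type*) : MvPowerSeries σ ℂ →ₐ[ℂ] ℂ :=
  { constantCoeff with commutes' := fun c => by simp [MvPowerSeries.algebraMap_apply] }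

theorem constantCoeffAlgHom_apply (f : MvPowerSeries σ ℂ) :
    constantCoeffAlgHom σ f = constantCoeff f := rfl

variable [Fintype σ] {τ : σ} {ρ e : MvPowerSeries σ ℂ}

/-- A power series all of whose tangential derivatives along `ρ = 0` vanish at the origin is
divisible by `ρ`. -/
theorem dvd_of_tang_vanish (h0 : constantCoeff ρ = 0) (he : e * pderiv ℂ τ ρ = 1)
    {l : List σ} (hl : l.Nodup) (hl' : ∀ i, i ∈ l) {f : MvPowerSeries σ ℂ}
    (hf : ∀ μ : σ →₀ ℕ,
      constantCoeff (dpow (fun i => tang (pderiv ℂ) e ρ τ i) l μ f) = 0) : ρ ∣ f := by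
  have he' : ∀ i u, e * pderiv ℂ τ ρ * pderiv ℂ i u = pderiv ℂ i u := fun i u => by
    rw [he, one_mul]
  have h1 : constantCoeff (pderiv ℂ τ ρ) ≠ 0 := fun h => by
    simpa [h] using congrArg constantCoeff he
  obtain ⟨q, r, rfl, hr⟩ := exists_eq_mul_add_of_pivot h0 h1 f
  let S := taylorHom (D := tang (pderiv ℂ) e ρ τ) (constantCoeffAlgHom σ)
    (tang_comm he' pderiv_comm) hl hl'
  have hSρ : S ρ = 0 := by
    refine pderiv.ext (fun i => ?_) ?_
    · rw [pderiv_taylorHom, tang_self he', map_zero, map_zero]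
    · rw [constantCoeff_taylorHom, map_zero]; exact h0
  have hSr : S r = r := by
    refine sub_eq_zero.1 (eq_zero_of_pderiv_stable
      (Q := fun g => ∃ r, pderiv ℂ τ r = 0 ∧ g = S r - r) ?_ ?_ ⟨r, hr, rfl⟩)
    · rintro _ ⟨r, -, rfl⟩
      rw [map_sub, constantCoeff_taylorHom]
      exact sub_self _
    · rintro i _ ⟨r, hr, rfl⟩
      refine ⟨pderiv ℂ i r, by rw [pderiv_comm, hr, map_zero], ?_⟩
      rw [map_sub, pderiv_taylorHom, tang_apply, hr, mul_zero, sub_zero]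
  have hSf : S (q * ρ + r) = 0 := by
    ext μ
    rw [coeff_taylorHom_eq_zero_iff _ _ _ _ _ μ |>.2 (hf μ), map_zero]
  rw [map_add, map_mul, hSρ, mul_zero, zero_add, hSr] at hSf
  rw [hSf, add_zero]
  exact dvd_mul_left _ _

end Division

theorem exists_det_ne_zero {R I ι : Type*} [CommRing R] [IsDomain R] [Fintype ι] [DecidableEq ι]
    (v : I → ι → R) (hv : ∀ a : ι → R, (∀ i, ∑ j, a j * v i j = 0) → a = 0) :
    ∃ α : ι → I, (Matrix.of fun k j => v (α k) j).det ≠ 0 := by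
  let K := FractionRing R
  let V : I → ι → K := fun i j => algebraMap R K (v i j)
  have hinj : Function.Injective (algebraMap R K) := IsFractionRing.injective R K
  have hspan : Submodule.span K (Set.range V) = ⊤ := by
    by_contra hne
    obtain ⟨φ, hφ, hle⟩ := Submodule.exists_le_ker_of_lt_top _ (lt_top_iff_ne_top.2 hne)
    obtain ⟨b, hb⟩ := IsLocalization.exist_integer_multiples_of_finite (nonZeroDivisors R)
      (fun j : ι => φ (Pi.single j 1))
    choose a ha using hb
    have ha0 : a = 0 := by
      refine hv a fun i => hinj ?_
      have h1 : φ (V i) = 0 := hle (Submodule.subset_span ⟨i, rfl⟩)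
      rw [LinearMap.pi_apply_eq_sum_univ] at h1
      have h2 : (b : R) • ∑ j, V i j • φ (fun k => if j = k then 1 else 0) = 0 := by
        rw [h1, smul_zero]
      rw [Finset.smul_sum] at h2
      rw [map_sum, map_zero, ← h2]
      refine Finset.sum_congr rfl fun j _ => ?_
      have h3 : (fun k => if j = k then (1 : K) else 0) = Pi.single j 1 := by
        ext k; simp [Pi.single_apply, eq_comm]
      rw [map_mul, ha, h3, smul_comm, smul_eq_mul, mul_comm]
    apply hφ
    refine LinearMap.pi_ext' fun j => LinearMap.ext_ring ?_
    have h4 := ha j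
    rw [ha0, Pi.zero_apply, map_zero, Algebra.smul_def, eq_comm, mul_eq_zero] at h4
    refine h4.resolve_left fun h => ?_
    exact nonZeroDivisors.coe_ne_zero b (hinj (h.trans (map_zero _).symm))
  obtain ⟨κ, f, -, hf, hli⟩ := exists_linearIndependent' K V
  let B := Module.Basis.mk hli (by rw [hf, hspan])
  let g := (Pi.basisFun K ι).indexEquiv B
  refine ⟨fun k => f (g k), fun h0 => ?_⟩
  have h5 : LinearIndependent K (fun k => V (f (g k))) := hli.comp g g.injective
  have h6 := (Matrix.linearIndependent_rows_iff_isUnit (K := K)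
    (A := Matrix.of fun k j => V (f (g k)) j)).1 h5
  rw [Matrix.isUnit_iff_isUnit_det] at h6
  apply h6.ne_zero
  have h7 := congrArg (algebraMap R K) h0
  rw [RingHom.map_det, map_zero] at h7
  exact h7

section EmbZ

variable {N : ℕ}

theorem coeff_embZ (a : MvPowerSeries (Fin N) ℂ) (μ : (Fin N ⊕ Fin N) →₀ ℕ)
    (h : ∀ m, μ (Sum.inr m) = 0) : coeff μ (embZ a) =
      coeff (Finsupp.comapDomain Sum.inl μ Sum.inl_injective.injOn) a := by
  change embZ a μ = _
  rw [embZ, dif_pos h]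

theorem coeff_embZ_of_ne (a : MvPowerSeries (Fin N) ℂ) (μ : (Fin N ⊕ Fin N) →₀ ℕ)
    {m : Fin N} (h : μ (Sum.inr m) ≠ 0) : coeff μ (embZ a) = 0 := by
  change embZ a μ = _
  rw [embZ, dif_neg fun h' => h (h' m)]

theorem pderiv_inr_embZ (i : Fin N) (a : MvPowerSeries (Fin N) ℂ) :
    pderiv ℂ (Sum.inr i) (embZ a) = 0 := by
  ext μ
  rw [coeff_pderiv, coeff_embZ_of_ne a _ (m := i) (by simp), zero_mul, map_zero]

theorem pderiv_inl_embZ (i : Fin N) (a : MvPowerSeries (Fin N) ℂ) :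
    pderiv ℂ (Sum.inl i) (embZ a) = embZ (pderiv ℂ i a) := by
  ext μ
  rw [coeff_pderiv]
  by_cases h : ∀ m, μ (Sum.inr m) = 0
  · rw [coeff_embZ _ _ h, coeff_embZ _ _ (by simpa using h), coeff_pderiv]
    have h1 : Finsupp.comapDomain Sum.inl (μ + Finsupp.single (Sum.inl i) 1)
        Sum.inl_injective.injOn =
          Finsupp.comapDomain Sum.inl μ Sum.inl_injective.injOn + Finsupp.single i 1 := by
      ext k
      simp [Finsupp.single_apply]
    rw [h1]
    rfl
  · push Not at h
    obtain ⟨m, hm⟩ := h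
    rw [coeff_embZ_of_ne _ _ hm, coeff_embZ_of_ne _ _ (m := m) (by simpa using hm), zero_mul]

theorem constantCoeff_embZ (a : MvPowerSeries (Fin N) ℂ) :
    constantCoeff (embZ a) = constantCoeff a := by
  rw [← coeff_zero_eq_constantCoeff_apply, coeff_embZ _ _ (by simp),
    ← coeff_zero_eq_constantCoeff_apply]
  exact congrArg (coeff · a) (by ext; simp)

end EmbZ

theorem nodup_sumList (N : ℕ) :
    ((List.finRange N).map Sum.inl ++ (List.finRange N).map Sum.inr :
      List (Fin N ⊕ Fin N)).Nodup := by
  refine List.Nodup.append ((List.nodup_finRange N).map Sum.inl_injective)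
    ((List.nodup_finRange N).map Sum.inr_injective) ?_
  simp [List.disjoint_left]

theorem mem_sumList (N : ℕ) (i : Fin N ⊕ Fin N) :
    i ∈ ((List.finRange N).map Sum.inl ++ (List.finRange N).map Sum.inr) := by
  cases i <;> simp

theorem dpow_sumList {N : ℕ} {A : Type*} (f : Fin N ⊕ Fin N → A → A) (μ : Fin N ⊕ Fin N → ℕ)
    (u : A) :
    dpow f ((List.finRange N).map Sum.inl ++ (List.finRange N).map Sum.inr) μ u =
      dpow (fun i => f (Sum.inl i)) (List.finRange N) (fun i => μ (Sum.inl i))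
        (dpow (fun i => f (Sum.inr i)) (List.finRange N) (fun i => μ (Sum.inr i)) u) := by
  rw [dpow_append, dpow_map, dpow_map]

/-- Formal core: if no nonzero formal holomorphic vector field is tangent to `ρ = 0`, then some
determinant of iterated CR derivatives of `ρ_z` has a nonzero tangential Taylor coefficient. -/
theorem exists_det_tang_ne_zero {n : ℕ} {m₀ : Fin (n + 1)}
    {ρ e : MvPowerSeries (Fin (n + 1) ⊕ Fin (n + 1)) ℂ} (h0 : constantCoeff ρ = 0)
    (he : e * pderiv ℂ (Sum.inr m₀) ρ = 1)
    (hnd : ∀ a : Fin (n + 1) → MvPowerSeries (Fin (n + 1)) ℂ,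
      ρ ∣ ∑ j, embZ (a j) * pderiv ℂ (Sum.inl j) ρ → a = 0) :
    ∃ (α : Fin (n + 1) → Fin n → ℕ) (β : Fin (n + 1) → ℕ),
      constantCoeff (dpow (fun i => tang (pderiv ℂ) e ρ (Sum.inr m₀) (Sum.inl i))
        (List.finRange (n + 1)) β
        (Matrix.of fun k j =>
          dpow (fun i => tang (pderiv ℂ) e ρ (Sum.inr m₀) (Sum.inr (m₀.succAbove i)))
            (List.finRange n) (α k) (pderiv ℂ (Sum.inl j) ρ)).det) ≠ 0 := by
  have he' : ∀ i u, e * pderiv ℂ (Sum.inr m₀) ρ * pderiv ℂ i u = pderiv ℂ i u := fun i u => by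
    rw [he, one_mul]
  have hcomm := tang_comm he' pderiv_comm
  set T := tang (pderiv ℂ) e ρ (Sum.inr m₀) with hT
  let Ψ := taylorHom (D := fun i => T (Sum.inl i)) (constantCoeffAlgHom _)
    (fun i j => hcomm (Sum.inl i) (Sum.inl j)) (List.nodup_finRange (n + 1)) List.mem_finRange
  have hTemb : ∀ i a, T (Sum.inr i) (embZ a) = 0 := fun i a => by
    rw [hT, tang_apply, pderiv_inr_embZ, pderiv_inr_embZ, mul_zero, sub_zero]
  have hTemb' : ∀ i a, T (Sum.inl i) (embZ a) = embZ (pderiv ℂ i a) := fun i a => by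
    rw [hT, tang_apply, pderiv_inr_embZ, mul_zero, sub_zero, pderiv_inl_embZ]
  have hΨemb : ∀ a, Ψ (embZ a) = a := by
    intro a
    refine sub_eq_zero.1 (eq_zero_of_pderiv_stable
      (Q := fun g => ∃ a, g = Ψ (embZ a) - a) ?_ ?_ ⟨a, rfl⟩)
    · rintro _ ⟨a, rfl⟩
      rw [map_sub, constantCoeff_taylorHom, constantCoeffAlgHom_apply, constantCoeff_embZ, sub_self]
    · rintro i _ ⟨a, rfl⟩
      refine ⟨pderiv ℂ i a, ?_⟩
      rw [map_sub, pderiv_taylorHom, hTemb']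
  let L : (Fin n → ℕ) → MvPowerSeries (Fin (n + 1) ⊕ Fin (n + 1)) ℂ →
      MvPowerSeries (Fin (n + 1) ⊕ Fin (n + 1)) ℂ := fun α =>
    dpow (fun i => T (Sum.inr (m₀.succAbove i))) (List.finRange n) α
  have : IsDomain (MvPowerSeries (Fin (n + 1)) ℂ) := NoZeroDivisors.to_isDomain _
  obtain ⟨α, hα⟩ := exists_det_ne_zero
    (fun (α : Fin n → ℕ) j => Ψ (L α (pderiv ℂ (Sum.inl j) ρ))) fun a ha => by
      refine hnd a (dvd_of_tang_vanish h0 he (nodup_sumList _) (mem_sumList _) fun μ => ?_)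
      rw [dpow_sumList]
      set f := ∑ j, embZ (a j) * pderiv ℂ (Sum.inl j) ρ with hf
      have hLf : ∀ α, L α f = ∑ j, embZ (a j) * L α (pderiv ℂ (Sum.inl j) ρ) := by
        intro α
        refine (dpow_semiconj (f := fun i u j => T (Sum.inr (m₀.succAbove i)) (u j))
          (fun u : Fin (n + 1) → MvPowerSeries (Fin (n + 1) ⊕ Fin (n + 1)) ℂ =>
            ∑ j, embZ (a j) * u j) (fun i u => ?_) (List.finRange n) α
            (fun j => pderiv ℂ (Sum.inl j) ρ)).symm.trans
          (Finset.sum_congr rfl fun j _ => congrArg _ (dpow_semiconj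
            (f := fun i u j => T (Sum.inr (m₀.succAbove i)) (u j)) (fun u => u j)
            (fun _ _ => rfl) _ _ _))
        simp only [map_sum, Derivation.leibniz, hTemb, smul_eq_mul, mul_zero, add_zero]
      have hQ : ∀ α, dpow (fun i => T (Sum.inr i)) (List.finRange (n + 1)) α f = 0 ∨
          ∃ α', dpow (fun i => T (Sum.inr i)) (List.finRange (n + 1)) α f = L α' f := by
        intro α
        refine dpow_induction (Q := fun g => g = 0 ∨ ∃ α', g = L α' f) (fun i g hg => ?_) _ _
          (Or.inr ⟨0, (dpow_zero _ _).symm⟩)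
        rcases hg with rfl | ⟨α', rfl⟩
        · exact Or.inl (map_zero _)
        · rcases Fin.eq_self_or_eq_succAbove m₀ i with rfl | ⟨k, rfl⟩
          · exact Or.inl (tang_pivot he' _)
          · exact Or.inr ⟨α' + Pi.single k 1, (dpow_add_single (fun i j => hcomm _ _)
              (List.nodup_finRange n) (List.mem_finRange k) α' f).symm⟩
      have hΨ : Ψ (dpow (fun i => T (Sum.inr i)) (List.finRange (n + 1))
          (fun i => μ (Sum.inr i)) f) = 0 := by
        rcases hQ (fun i => μ (Sum.inr i)) with h | ⟨α', h⟩
        · rw [h, map_zero]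
        · rw [h, hLf, map_sum]
          simpa only [map_mul, hΨemb] using ha α'
      have := (coeff_taylorHom_eq_zero_iff _ _ _ _ _
        (Finsupp.comapDomain Sum.inl μ Sum.inl_injective.injOn)).1
          ((congrArg (coeff _) hΨ).trans (map_zero _))
      exact this
  have h1 : (Matrix.of fun k j => Ψ (L (α k) (pderiv ℂ (Sum.inl j) ρ))).det =
      Ψ (Matrix.of fun k j => L (α k) (pderiv ℂ (Sum.inl j) ρ)).det := by
    rw [RingHom.map_det]; rfl
  rw [h1, MvPowerSeries.ne_zero_iff_exists_coeff_ne_zero] at hα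
  obtain ⟨β, hβ⟩ := hα
  exact ⟨α, β, fun h => hβ ((coeff_taylorHom_eq_zero_iff _ _ _ _ _ β).2 h)⟩

variable {N : ℕ}

/-- The Wirtinger derivatives `∂/∂z_m` and `∂/∂z̄_m`, indexed by a sum type. -/
def wd (i : Fin N ⊕ Fin N) : (CPt N → ℂ) → CPt N → ℂ := Sum.elim wz wzb i

theorem wd_eq (i : Fin N ⊕ Fin N) : ∃ (v w : CPt N) (s : ℂ), ∀ u z,
    wd i u z = (1 / 2) * (fderiv ℝ u z v + s * fderiv ℝ u z w) := by
  rcases i with m | m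
  · exact ⟨Pi.single m 1, Pi.single m Complex.I, -Complex.I, fun u z => by simp [wd, wz]; ring⟩
  · exact ⟨Pi.single m 1, Pi.single m Complex.I, Complex.I, fun u z => by simp [wd, wzb]⟩

theorem wd_congr {U : Set (CPt N)} (hU : IsOpen U) (i : Fin N ⊕ Fin N) {u v : CPt N → ℂ}
    (h : Set.EqOn u v U) : Set.EqOn (wd i u) (wd i v) U := by
  intro z hz
  obtain ⟨a, b, s, hi⟩ := wd_eq i
  rw [hi, hi, (h.eventuallyEq_of_mem (hU.mem_nhds hz)).fderiv_eq]

theorem contDiffOn_wd {U : Set (CPt N)} (hU : IsOpen U) (i : Fin N ⊕ Fin N) {u : CPt N → ℂ}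
    (hu : ContDiffOn ℝ (⊤ : ℕ∞) u U) : ContDiffOn ℝ (⊤ : ℕ∞) (wd i u) U := by
  obtain ⟨a, b, s, hi⟩ := wd_eq i
  have h1 : ContDiffOn ℝ (⊤ : ℕ∞) (fderiv ℝ u) U := hu.fderiv_of_isOpen hU (by simp)
  rw [show wd i u = _ from funext fun z => hi u z]
  exact contDiffOn_const.mul ((h1.clm_apply contDiffOn_const).add
    (contDiffOn_const.mul (h1.clm_apply contDiffOn_const)))

theorem wd_comm {U : Set (CPt N)} (hU : IsOpen U) (i j : Fin N ⊕ Fin N) {u : CPt N → ℂ}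
    (hu : ContDiffOn ℝ (⊤ : ℕ∞) u U) {z : CPt N} (hz : z ∈ U) :
    wd i (wd j u) z = wd j (wd i u) z := by
  obtain ⟨a, b, s, hi⟩ := wd_eq i
  obtain ⟨a', b', s', hj⟩ := wd_eq j
  have h1 : DifferentiableAt ℝ (fderiv ℝ u) z :=
    ((hu.fderiv_of_isOpen (m := (⊤ : ℕ∞)) hU (by simp)).differentiableOn (by simp)).differentiableAt
      (hU.mem_nhds hz)
  have hsymm : IsSymmSndFDerivAt ℝ u z :=
    (hu.contDiffAt (hU.mem_nhds hz)).isSymmSndFDerivAt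
      (by simpa using WithTop.coe_le_coe.2 (le_top : (2 : ℕ∞) ≤ ⊤))
  have key : ∀ (v w : CPt N) (s : ℂ) (x : CPt N),
      fderiv ℝ (fun z => (1 / 2) * (fderiv ℝ u z v + s * fderiv ℝ u z w)) z x =
        (1 / 2) * (fderiv ℝ (fderiv ℝ u) z x v + s * fderiv ℝ (fderiv ℝ u) z x w) := by
    intro v w s x
    have hd : ∀ v, HasFDerivAt (fun z => fderiv ℝ u z v)
        ((ContinuousLinearMap.apply ℝ ℂ v).comp (fderiv ℝ (fderiv ℝ u) z)) z := fun v =>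
      (ContinuousLinearMap.apply ℝ ℂ v).hasFDerivAt.comp z h1.hasFDerivAt
    have h : HasFDerivAt (fun z => (1 / 2) * (fderiv ℝ u z v + s * fderiv ℝ u z w)) _ z :=
      ((hd v).add ((hd w).const_mul s)).const_mul (1 / 2)
    rw [h.fderiv]
    simp [mul_add]
  rw [hi, hj, show wd j u = _ from funext fun z => hj u z,
    show wd i u = _ from funext fun z => hi u z, key, key, key, key,
    hsymm.eq a a', hsymm.eq a b', hsymm.eq b a', hsymm.eq b b']
  ring

/-- The algebra of functions which are smooth on `U`. -/
def smoothOn (U : Set (CPt N)) : Subalgebra ℂ (CPt N → ℂ) where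
  carrier := {u | ContDiffOn ℝ (⊤ : ℕ∞) u U}
  mul_mem' ha hb := ContDiffOn.mul ha hb
  add_mem' ha hb := ContDiffOn.add ha hb
  algebraMap_mem' _ := contDiffOn_const

theorem smoothOn.contDiffOn {U : Set (CPt N)} (u : smoothOn U) :
    ContDiffOn ℝ (⊤ : ℕ∞) (u : CPt N → ℂ) U := u.2

theorem smoothOn.differentiableAt {U : Set (CPt N)} (hU : IsOpen U) (u : smoothOn U) {z : CPt N}
    (hz : z ∈ U) : DifferentiableAt ℝ (u : CPt N → ℂ) z :=
  ((smoothOn.contDiffOn u).differentiableOn (by simp)).differentiableAt (hU.mem_nhds hz)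

section

variable {U : Set (CPt N)} (hU : IsOpen U)

/-- The Wirtinger derivatives as derivations of the algebra of smooth functions on `U`; outside
`U` the derivative is set to zero. -/
def wD (i : Fin N ⊕ Fin N) : Derivation ℂ (smoothOn U) (smoothOn U) :=
  have hmem : ∀ u : smoothOn U, U.indicator (wd i u) ∈ smoothOn U := fun u =>
    (contDiffOn_wd hU i (smoothOn.contDiffOn u)).congr fun _ hz => Set.indicator_of_mem hz _
  Derivation.mk'
    { toFun := fun u => ⟨U.indicator (wd i u), hmem u⟩
      map_add' := fun u v => by
        ext z
        obtain ⟨a, b, s, hi⟩ := wd_eq i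
        by_cases hz : z ∈ U
        · have h := fderiv_add (smoothOn.differentiableAt hU u hz) (smoothOn.differentiableAt hU v hz)
          simp [hz, hi, h]
          ring
        · simp [hz]
      map_smul' := fun c u => by
        ext z
        obtain ⟨a, b, s, hi⟩ := wd_eq i
        by_cases hz : z ∈ U
        · have h := fderiv_const_smul (smoothOn.differentiableAt hU u hz) c
          simp [hz, hi, h]
          ring
        · simp [hz] }
    fun u v => by
      ext z
      obtain ⟨a, b, s, hi⟩ := wd_eq i
      by_cases hz : z ∈ U
      · have h := fderiv_mul (smoothOn.differentiableAt hU u hz) (smoothOn.differentiableAt hU v hz)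
        simp [hz, hi, h]
        ring
      · simp [hz]

theorem wD_apply (i : Fin N ⊕ Fin N) (u : smoothOn U) {z : CPt N} (hz : z ∈ U) :
    (wD hU i u : CPt N → ℂ) z = wd i u z := Set.indicator_of_mem hz _

theorem wD_apply_of_notMem (i : Fin N ⊕ Fin N) (u : smoothOn U) {z : CPt N} (hz : z ∉ U) :
    (wD hU i u : CPt N → ℂ) z = 0 := Set.indicator_of_notMem hz _

theorem wD_eqOn (i : Fin N ⊕ Fin N) {u : CPt N → ℂ} {v : smoothOn U} (h : Set.EqOn u v U) :
    Set.EqOn (wd i u) (wD hU i v) U := fun z hz => by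
  rw [wD_apply hU i v hz, wd_congr hU i h hz]

theorem wD_comm (i j : Fin N ⊕ Fin N) (u : smoothOn U) :
    wD hU i (wD hU j u) = wD hU j (wD hU i u) := by
  ext z
  by_cases hz : z ∈ U
  · have h : ∀ i j, (wD hU i (wD hU j u) : CPt N → ℂ) z = wd i (wd j u) z := fun i j =>
      (wD_eqOn hU i (wD_eqOn hU j fun _ _ => rfl) hz).symm
    rw [h, h, wd_comm hU i j (smoothOn.contDiffOn u) hz]
  · rw [wD_apply_of_notMem hU _ _ hz, wD_apply_of_notMem hU _ _ hz]

/-- Evaluation at a point. -/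
def evAt (U : Set (CPt N)) (p : CPt N) : smoothOn U →ₐ[ℂ] ℂ :=
  (Pi.evalAlgHom ℂ (fun _ : CPt N => ℂ) p).comp (smoothOn U).val

theorem evAt_apply (p : CPt N) (u : smoothOn U) : evAt U p u = (u : CPt N → ℂ) p := rfl

/-- The complexified Taylor expansion as a ring homomorphism. -/
def cTaylorHom (p : CPt N) : smoothOn U →+* MvPowerSeries (Fin N ⊕ Fin N) ℂ :=
  taylorHom (evAt U p) (wD_comm hU) (nodup_sumList N) (mem_sumList N)

theorem cTaylor_eq {p : CPt N} (hp : p ∈ U) {u : CPt N → ℂ} {v : smoothOn U}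
    (h : Set.EqOn u v U) : cTaylor u p = cTaylorHom hU p v := by
  ext μ
  have h1 : coeff μ (cTaylor u p) =
      dpow wd ((List.finRange N).map Sum.inl ++ (List.finRange N).map Sum.inr) μ u p /
        ((∏ i, (μ i).factorial : ℕ) : ℂ) := by
    rw [dpow_sumList, Fintype.prod_sum_type]
    rfl
  rw [h1, cTaylorHom, coeff_taylorHom, evAt_apply]
  congr 1
  exact dpow_rel (f := wd) (g := fun i => wD hU i)
    (R := fun u v => Set.EqOn u (v : CPt N → ℂ) U) (fun i u v huv => wD_eqOn hU i huv) _ _ h hp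

theorem pderiv_cTaylorHom (p : CPt N) (i : Fin N ⊕ Fin N) (u : smoothOn U) :
    pderiv ℂ i (cTaylorHom hU p u) = cTaylorHom hU p (wD hU i u) :=
  pderiv_taylorHom ..

theorem constantCoeff_cTaylorHom (p : CPt N) (u : smoothOn U) :
    constantCoeff (cTaylorHom hU p u) = (u : CPt N → ℂ) p :=
  constantCoeff_taylorHom ..

/-- A function vanishing on a level set of `ρ` has differential proportional to that of `ρ`. -/
theorem exists_fderiv_eq_smul {ρ : CPt N → ℝ} {p : CPt N} (hρ : ContDiffAt ℝ (⊤ : ℕ∞) ρ p)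
    (hdρ : fderiv ℝ ρ p ≠ 0) {u : CPt N → ℂ} (hu : ContDiffAt ℝ (⊤ : ℕ∞) u p)
    (h0 : ∀ᶠ z in nhds p, ρ z = ρ p → u z = u p) :
    ∃ c : ℂ, ∀ x, fderiv ℝ u p x = c * fderiv ℝ ρ p x := by
  have key : ∀ ℓ : ℂ →L[ℝ] ℝ, ∃ c : ℝ, ∀ x, ℓ (fderiv ℝ u p x) = c * fderiv ℝ ρ p x := by
    intro ℓ
    have hs : HasStrictFDerivAt (fun z => ℓ (u z)) (ℓ.comp (fderiv ℝ u p)) p :=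
      ℓ.hasStrictFDerivAt.comp p (hu.hasStrictFDerivAt (by simp))
    have hext : IsLocalExtrOn (fun z => ℓ (u z)) {z | ρ z = ρ p} p := by
      refine Or.inl ?_
      filter_upwards [self_mem_nhdsWithin, nhdsWithin_le_nhds h0] with z hz hz'
      rw [hz' hz]
    obtain ⟨a, b, hab, h⟩ := hext.exists_multipliers_of_hasStrictFDerivAt_1d
      (hρ.hasStrictFDerivAt (by simp)) hs
    have hb : b ≠ 0 := by
      rintro rfl
      rw [zero_smul, add_zero] at h
      rcases smul_eq_zero.1 h with rfl | h
      · exact hab rfl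
      · exact hdρ h
    refine ⟨-a / b, fun x => ?_⟩
    have := congrArg (fun A : CPt N →L[ℝ] ℝ => A x) h
    simp at this
    field_simp
    linarith
  obtain ⟨c, hc⟩ := key Complex.reCLM
  obtain ⟨d, hd⟩ := key Complex.imCLM
  refine ⟨⟨c, d⟩, fun x => Complex.ext ?_ ?_⟩
  · simpa using hc x
  · simpa using hd x

end

theorem fderiv_ofReal_comp {ρ : CPt N → ℝ} {p : CPt N} (hρ : DifferentiableAt ℝ ρ p) (x : CPt N) :
    fderiv ℝ (fun w => ((ρ w : ℝ) : ℂ)) p x = ((fderiv ℝ ρ p x : ℝ) : ℂ) := by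
  have := (Complex.ofRealCLM.hasFDerivAt.comp p hρ.hasFDerivAt).fderiv
  rw [show (fun w => ((ρ w : ℝ) : ℂ)) = Complex.ofRealCLM ∘ ρ from rfl, this]
  rfl

theorem wz_ofReal_eq_star_wzb {ρ : CPt N → ℝ} {p : CPt N} (hρ : DifferentiableAt ℝ ρ p)
    (m : Fin N) : wz m (fun w => ((ρ w : ℝ) : ℂ)) p = star (wzb m (fun w => ((ρ w : ℝ) : ℂ)) p) := by
  rw [wz, wzb, fderiv_ofReal_comp hρ, fderiv_ofReal_comp hρ]
  simp [sub_eq_add_neg]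

/-- For a real function with nonzero differential, some `∂ρ/∂z̄_m` is nonzero. -/
theorem exists_wzb_ne_zero {ρ : CPt N → ℝ} {p : CPt N} (hρ : DifferentiableAt ℝ ρ p)
    (hdρ : fderiv ℝ ρ p ≠ 0) : ∃ m, wzb m (fun w => ((ρ w : ℝ) : ℂ)) p ≠ 0 := by
  by_contra! h
  apply hdρ
  have h2 : ∀ m, fderiv ℝ ρ p (Pi.single m 1) = 0 ∧ fderiv ℝ ρ p (Pi.single m Complex.I) = 0 := by
    intro m
    have := h m
    rw [wzb, fderiv_ofReal_comp hρ, fderiv_ofReal_comp hρ, mul_eq_zero, or_iff_right (by norm_num)] at this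
    rw [Complex.ext_iff] at this
    simpa using this
  ext x
  have hx : x = ∑ m, ((x m).re • (Pi.single m 1 : CPt N) + (x m).im • (Pi.single m Complex.I : CPt N)) := by
    ext m
    simp [Finset.sum_apply, Pi.single_apply, Finset.sum_add_distrib]
  rw [hx, map_sum]
  simp [h2]

/-- Lower semicontinuity of the rank of a family of vectors depending on a point. -/
theorem eventually_finrank_span_le {X κ E : Type*} [TopologicalSpace X] [NormedAddCommGroup E]
    [NormedSpace ℂ E] [FiniteDimensional ℂ E] {v : κ → X → E} {p : X}
    (hv : ∀ α, ContinuousAt (v α) p) (S : Set κ) :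
    ∀ᶠ z in 𝓝 p, Module.finrank ℂ (Submodule.span ℂ ((fun α => v α p) '' S)) ≤
      Module.finrank ℂ (Submodule.span ℂ ((fun α => v α z) '' S)) := by
  obtain ⟨f, hf, -, hli⟩ := Submodule.exists_fun_fin_finrank_span_eq ℂ ((fun α => v α p) '' S)
  choose α hαS hα using hf
  have hc : ContinuousAt (fun z i => v (α i) z) p := continuousAt_pi.2 fun i => hv _
  rw [← show (fun i => v (α i) p) = f from funext hα] at hli
  filter_upwards [hc.eventually hli.eventually] with z hz
  rw [← Fintype.card_fin (Module.finrank ℂ (Submodule.span ℂ ((fun α => v α p) '' S))),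
    ← finrank_span_eq_card hz]
  refine Submodule.finrank_mono (Submodule.span_mono ?_)
  rintro _ ⟨i, rfl⟩
  exact ⟨α i, hαS i, rfl⟩

/-- If `w` is pointwise a linear combination of the `v i`, which are independent at `q`, then the
derivative of `w` at `q` lies in any subspace containing the values and derivatives of the `v i`. -/
theorem derivation_mem_of_mem_span {A T m : Type*} [CommRing A] [Algebra ℂ A] [Fintype m]
    [DecidableEq m] (ev : T → A →ₐ[ℂ] ℂ) (X : Derivation ℂ A A)
    (hX : ∀ u, (∀ t, ev t u = 0) → ∀ t, ev t (X u) = 0) {r : ℕ} (v : Fin r → m → A) (w : m → A)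
    (hw : ∀ t, (fun l => ev t (w l)) ∈ Submodule.span ℂ (Set.range fun i l => ev t (v i l)))
    (q : T) (hli : LinearIndependent ℂ fun i l => ev q (v i l)) (E : Submodule ℂ (m → ℂ))
    (hv : ∀ i, (fun l => ev q (v i l)) ∈ E) (hXv : ∀ i, (fun l => ev q (X (v i l))) ∈ E) :
    (fun l => ev q (X (w l))) ∈ E := by
  obtain ⟨P, hP⟩ : ∃ P : Matrix (Fin r) m ℂ,
      P * Matrix.of (fun l i => ev q (v i l)) = 1 := by
    have h := (Matrix.mulVec_injective_iff
      (M := Matrix.of (fun l i => ev q (v i l)))).2 (by exact hli)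
    obtain ⟨P, hP⟩ := LinearMap.exists_leftInverse_of_injective
      (Matrix.mulVecLin (Matrix.of (fun l i => ev q (v i l)))) (LinearMap.ker_eq_bot.2 h)
    refine ⟨LinearMap.toMatrix' P, ?_⟩
    have := congrArg LinearMap.toMatrix' hP
    rwa [LinearMap.toMatrix'_comp, LinearMap.toMatrix'_id, ← Matrix.toLin'_apply',
      LinearMap.toMatrix'_toLin'] at this
  set PA : Matrix (Fin r) m A := P.map (algebraMap ℂ A) with hPA
  set V : Matrix m (Fin r) A := Matrix.of fun l i => v i l with hV
  set G : Matrix (Fin r) (Fin r) A := PA * V with hG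
  set b : Fin r → A := G.adjugate.mulVec (PA.mulVec w) with hb
  have hevV : ∀ t, V.map (ev t) = Matrix.of fun l i => ev t (v i l) := fun t => rfl
  have hevP : ∀ t, PA.map (ev t) = P := fun t => by ext; simp [hPA]
  have hrel : ∀ l t, ev t (G.det * w l - ∑ i, b i * v i l) = 0 := by
    intro l t
    obtain ⟨c, hc⟩ := (Submodule.mem_span_range_iff_exists_fun ℂ).1 (hw t)
    have hwc : ev t ∘ w = (V.map (ev t)).mulVec c := by
      ext l
      have := congrFun hc l
      simp only [Finset.sum_apply, Pi.smul_apply, smul_eq_mul] at this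
      simp [Matrix.mulVec, dotProduct, hV, ← this, mul_comm]
    have hevb : ev t ∘ b = (G.map (ev t)).det • c := by
      have h1 : ev t ∘ b = (G.map (ev t)).adjugate.mulVec
          ((PA.map (ev t)).mulVec (ev t ∘ w)) := by
        have hadj : G.adjugate.map (ev t) = (G.map (ev t)).adjugate := AlgHom.map_adjugate (ev t) G
        rw [← hadj]
        ext i
        refine (RingHom.map_mulVec (ev t : A →+* ℂ) _ _ i).trans ?_
        congr 2
        ext j
        exact RingHom.map_mulVec (ev t : A →+* ℂ) _ _ j
      have hGm : G.map (ev t) = PA.map (ev t) * V.map (ev t) := Matrix.map_mul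
      rw [h1, hwc, Matrix.mulVec_mulVec _ (PA.map (ev t)), ← hGm, Matrix.mulVec_mulVec, Matrix.adjugate_mul,
        Matrix.smul_mulVec, Matrix.one_mulVec]
    have hdet : ev t G.det = (G.map (ev t)).det := AlgHom.map_det (ev t) G
    have hl := congrFun hwc l
    have hb' : ∀ i, ev t (b i) = (G.map (ev t)).det * c i := fun i => congrFun hevb i
    simp only [Function.comp, Matrix.mulVec, dotProduct, hV, Matrix.map_apply, Matrix.of_apply] at hl
    simp only [map_sub, map_mul, map_sum, hb', hdet, hl, Finset.mul_sum]
    rw [← Finset.sum_sub_distrib]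
    exact Finset.sum_eq_zero fun i _ => by ring
  have hGq : ev q G.det = 1 := by
    rw [AlgHom.map_det]
    have : (ev q).mapMatrix G = PA.map (ev q) * V.map (ev q) := Matrix.map_mul
    rw [this, hevP, hevV, hP, Matrix.det_one]
  have hwE : (fun l => ev q (w l)) ∈ E :=
    Submodule.span_le.2 (by rintro _ ⟨i, rfl⟩; exact hv i) (hw q)
  have hfin : (fun l => ev q (X (w l))) = -(ev q (X G.det) • fun l => ev q (w l)) +
      ∑ i, (ev q (b i) • (fun l => ev q (X (v i l))) + ev q (X (b i)) • fun l => ev q (v i l)) := by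
    ext l
    have := hX _ (hrel l) q
    simp only [map_sub, map_sum, Derivation.leibniz, smul_eq_mul, map_add, map_mul, hGq] at this
    simp only [Pi.add_apply, Pi.neg_apply, Pi.smul_apply, Finset.sum_apply, smul_eq_mul]
    simp only [mul_comm (ev q (v _ _))] at this
    linear_combination this
  rw [hfin]
  exact E.add_mem (E.neg_mem (E.smul_mem _ hwE)) (E.sum_mem fun i _ =>
    E.add_mem (E.smul_mem _ (hXv i)) (E.smul_mem _ (hv i)))

section

variable {N n : ℕ} {U : Set (CPt N)}

/-- The iterated derivatives `L^α w` of a vector of functions, taken componentwise. -/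
def vecPow (L : Fin n → Derivation ℂ (smoothOn U) (smoothOn U)) (w : Fin N → smoothOn U)
    (α : Fin n → ℕ) : Fin N → smoothOn U :=
  dpow (fun j w m => L j (w m)) (List.finRange n) α w

/-- The value at `z` of a vector of functions. -/
def vecAt (z : CPt N) (w : Fin N → smoothOn U) : Fin N → ℂ := fun m => evAt U z (w m)

/-- The span of the values at `z` of the derivatives `L^α w` of order at most `k`. -/
def jetSpan (L : Fin n → Derivation ℂ (smoothOn U) (smoothOn U)) (w : Fin N → smoothOn U) (k : ℕ)
    (z : CPt N) : Submodule ℂ (CPt N) :=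
  Submodule.span ℂ ((fun α => vecAt z (vecPow L w α)) '' {α | ∑ j, α j ≤ k})

variable {L : Fin n → Derivation ℂ (smoothOn U) (smoothOn U)} {w : Fin N → smoothOn U}

theorem vecPow_apply (α : Fin n → ℕ) (m : Fin N) :
    vecPow L w α m = dpow (fun j => L j) (List.finRange n) α (w m) :=
  dpow_semiconj (fun w : Fin N → smoothOn U => w m) (fun _ _ => rfl) _ _ _

theorem vecPow_add_single (hL : ∀ i j u, L i (L j u) = L j (L i u)) (α : Fin n → ℕ) (j : Fin n) :
    vecPow L w (α + Pi.single j 1) = fun m => L j (vecPow L w α m) :=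
  dpow_add_single (fun i j u => funext fun m => hL i j (u m)) (List.nodup_finRange n)
    (List.mem_finRange j) α w

theorem vecAt_mem_jetSpan {k : ℕ} {α : Fin n → ℕ} (hα : ∑ j, α j ≤ k) (z : CPt N) :
    vecAt z (vecPow L w α) ∈ jetSpan L w k z :=
  Submodule.subset_span ⟨α, hα, rfl⟩

theorem jetSpan_mono {k l : ℕ} (h : k ≤ l) (z : CPt N) : jetSpan L w k z ≤ jetSpan L w l z :=
  Submodule.span_mono (Set.image_mono fun _ hα => le_trans hα h)

theorem continuousAt_vecAt (hU : IsOpen U) {z : CPt N} (hz : z ∈ U) (w : Fin N → smoothOn U) :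
    ContinuousAt (fun z => vecAt z w) z :=
  continuousAt_pi.2 fun m => (smoothOn.differentiableAt hU (w m) hz).continuousAt

theorem eventually_finrank_jetSpan_le (hU : IsOpen U) {z : CPt N} (hz : z ∈ U) (k : ℕ) :
    ∀ᶠ z' in 𝓝 z, Module.finrank ℂ (jetSpan L w k z) ≤ Module.finrank ℂ (jetSpan L w k z') :=
  eventually_finrank_span_le (v := fun α z => vecAt z (vecPow L w α))
    (fun _ => continuousAt_vecAt hU hz _) _

/-- If the spans of orders `k` and `k + 1` agree and have constant rank along `Z`, then all
higher derivatives lie in the span of order `k`. -/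
theorem vecAt_mem_jetSpan_of_stable (hU : IsOpen U) {Z : Set (CPt N)} (hZU : Z ⊆ U)
    (hL : ∀ i j u, L i (L j u) = L j (L i u))
    (hLZ : ∀ j (O : Set (CPt N)) (u : smoothOn U), IsOpen O → (∀ z ∈ Z ∩ O, evAt U z u = 0) →
      ∀ z ∈ Z ∩ O, evAt U z (L j u) = 0)
    {k r : ℕ} (hr : ∀ z ∈ Z, Module.finrank ℂ (jetSpan L w k z) = r)
    (hr' : ∀ z ∈ Z, Module.finrank ℂ (jetSpan L w (k + 1) z) = r) (α : Fin n → ℕ) :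
    ∀ z ∈ Z, vecAt z (vecPow L w α) ∈ jetSpan L w k z := by
  refine dpow_induction (Q := fun v : Fin N → smoothOn U => ∀ z ∈ Z, vecAt z v ∈ jetSpan L w k z)
    (fun j v hv z hz => ?_) _ α fun z _ => ?_
  · obtain ⟨β, hβ, hli⟩ : ∃ β : Fin r → Fin n → ℕ, (∀ i, ∑ j, β i j ≤ k) ∧
        LinearIndependent ℂ fun i => vecAt z (vecPow L w (β i)) := by
      obtain ⟨f, hf, -, hli⟩ := Submodule.exists_fun_fin_finrank_span_eq ℂ
        ((fun α => vecAt z (vecPow L w α)) '' {α | ∑ j, α j ≤ k})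
      choose β hβ hβf using hf
      rw [← show (fun i => vecAt z (vecPow L w (β i))) = f from funext hβf] at hli
      rw [← hr z hz]
      exact ⟨β, hβ, hli⟩
    have hc : ContinuousAt (fun z i => vecAt z (vecPow L w (β i))) z :=
      continuousAt_pi.2 fun i => continuousAt_vecAt hU (hZU hz) _
    obtain ⟨O, hO, hOo, hzO⟩ := eventually_nhds_iff.1 (hc.eventually hli.eventually)
    have hspan : ∀ t ∈ Z ∩ O,
        Submodule.span ℂ (Set.range fun i => vecAt t (vecPow L w (β i))) = jetSpan L w k t := by
      intro t ht
      refine Submodule.eq_of_le_of_finrank_eq (Submodule.span_le.2 ?_) ?_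
      · rintro _ ⟨i, rfl⟩
        exact vecAt_mem_jetSpan (hβ i) t
      · rw [hr t ht.1, finrank_span_eq_card (hO t ht.2), Fintype.card_fin]
    have hE : jetSpan L w k z = jetSpan L w (k + 1) z :=
      Submodule.eq_of_le_of_finrank_eq (jetSpan_mono k.le_succ z) (by rw [hr z hz, hr' z hz])
    refine derivation_mem_of_mem_span (T := (Z ∩ O : Set (CPt N))) (fun t => evAt U t) (L j)
      (fun u hu t => hLZ j O u hOo (fun z hz => hu ⟨z, hz⟩) t t.2) (fun i => vecPow L w (β i)) v
      (fun t => ?_) ⟨z, hz, hzO⟩ hli _ (fun i => vecAt_mem_jetSpan (hβ i) z) fun i => ?_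
    · exact (hspan t t.2).symm ▸ hv t t.2.1
    · rw [hE]
      have := vecAt_mem_jetSpan (L := L) (w := w) (k := k + 1) (α := β i + Pi.single j 1)
        (by simpa [Finset.sum_add_distrib] using hβ i) z
      rwa [vecPow_add_single hL] at this
  · simpa [vecPow, dpow_zero] using vecAt_mem_jetSpan (L := L) (w := w) (α := 0) (k := k) (by simp) z

/-- Along a set where the derivatives of order at most `n` never span, all derivatives lie, on some
nonempty relatively open subset, in the span of those of order at most `n`. -/
theorem exists_isOpen_vecAt_mem_jetSpan (hU : IsOpen U) {Z : Set (CPt N)} (hZU : Z ⊆ U)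
    (hZ : Z.Nonempty) (hL : ∀ i j u, L i (L j u) = L j (L i u))
    (hLZ : ∀ j (O : Set (CPt N)) (u : smoothOn U), IsOpen O → (∀ z ∈ Z ∩ O, evAt U z u = 0) →
      ∀ z ∈ Z ∩ O, evAt U z (L j u) = 0)
    (hw : ∀ z ∈ Z, vecAt z w ≠ 0)
    (hn : ∀ z ∈ Z, Module.finrank ℂ (jetSpan L w n z) ≤ n) :
    ∃ O, IsOpen O ∧ (Z ∩ O).Nonempty ∧
      ∀ z ∈ Z ∩ O, ∀ α, vecAt z (vecPow L w α) ∈ jetSpan L w n z := by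
  set F : CPt N → ℕ := fun z => ∑ k ∈ Finset.range (n + 1), Module.finrank ℂ (jetSpan L w k z)
  have hbdd : BddAbove (F '' Z) := by
    refine ⟨∑ k ∈ Finset.range (n + 1), N, ?_⟩
    rintro _ ⟨z, -, rfl⟩
    exact Finset.sum_le_sum fun k _ => (Submodule.finrank_le _).trans (by simp)
  obtain ⟨q, hq, hqF⟩ := Nat.sSup_mem (hZ.image F) hbdd
  have hmax : ∀ z ∈ Z, F z ≤ F q := fun z hz => hqF ▸ le_csSup hbdd ⟨z, hz, rfl⟩
  have hev : ∀ᶠ z in 𝓝 q, ∀ k ∈ Finset.range (n + 1),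
      Module.finrank ℂ (jetSpan L w k q) ≤ Module.finrank ℂ (jetSpan L w k z) :=
    (Filter.eventually_all_finset _).2 fun k _ => eventually_finrank_jetSpan_le hU (hZU hq) k
  obtain ⟨O, hO, hOo, hqO⟩ := eventually_nhds_iff.1 hev
  have hconst : ∀ z ∈ Z ∩ O, ∀ k ≤ n,
      Module.finrank ℂ (jetSpan L w k z) = Module.finrank ℂ (jetSpan L w k q) := by
    intro z hz k hk
    have hsum := le_antisymm (Finset.sum_le_sum (hO z hz.2)) (hmax z hz.1)
    exact ((Finset.sum_eq_sum_iff_of_le (hO z hz.2)).1 hsum k (by simpa [Nat.lt_succ_iff])).symm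
  obtain ⟨k, hk, hkk⟩ : ∃ k < n, Module.finrank ℂ (jetSpan L w k q) =
      Module.finrank ℂ (jetSpan L w (k + 1) q) := by
    by_contra! hne
    have hgrow : ∀ k ≤ n, k + 1 ≤ Module.finrank ℂ (jetSpan L w k q) := by
      intro k
      induction k with
      | zero =>
        intro _
        rw [zero_add, Nat.one_le_iff_ne_zero, Ne, Submodule.finrank_eq_zero]
        intro h
        refine hw q hq ?_
        have h0 := vecAt_mem_jetSpan (L := L) (w := w) (α := 0) (k := 0) (by simp) q
        rwa [h, Submodule.mem_bot, vecPow, dpow_zero] at h0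
      | succ k ih =>
        intro hk
        have h1 := ih (by omega)
        have h2 := hne k (by omega)
        have h3 := Submodule.finrank_mono (jetSpan_mono (L := L) (w := w) (Nat.le_add_right k 1) q)
        omega
    have h1 := hgrow n le_rfl
    have h2 := hn q hq
    omega
  refine ⟨O, hOo, ⟨q, hq, hqO⟩, fun z hz α => jetSpan_mono hk.le z ?_⟩
  refine vecAt_mem_jetSpan_of_stable hU (fun z hz => hZU hz.1) hL (fun j O' u hO' hu z hz => ?_)
    (fun z hz => hconst z hz k hk.le) (fun z hz => (hconst z hz (k + 1) hk).trans hkk.symm) α z hz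
  rw [Set.inter_assoc] at hu hz
  exact hLZ j _ u (hOo.inter hO') hu z hz

end

section

variable {n : ℕ} {U : Set (CPt (n + 1))} {ρ : CPt (n + 1) → ℝ} {m₀ : Fin (n + 1)}
  {ρA e : smoothOn U}

theorem evAt_wD_inr (hU : IsOpen U) (hρA : (ρA : CPt (n + 1) → ℂ) = fun w => ((ρ w : ℝ) : ℂ))
    {m : Fin (n + 1)} {z : CPt (n + 1)} (hz : z ∈ U) :
    evAt U z (wD hU (Sum.inr m) ρA) = wzb m (fun w => ((ρ w : ℝ) : ℂ)) z := by
  rw [evAt_apply, wD_apply hU _ _ hz, hρA]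
  rfl

theorem mul_wD_pivot (hU : IsOpen U) (hρA : (ρA : CPt (n + 1) → ℂ) = fun w => ((ρ w : ℝ) : ℂ))
    (he : ∀ z ∈ U, evAt U z e * wzb m₀ (fun w => ((ρ w : ℝ) : ℂ)) z = 1)
    (i : Fin (n + 1) ⊕ Fin (n + 1)) (u : smoothOn U) :
    e * wD hU (Sum.inr m₀) ρA * wD hU i u = wD hU i u := by
  ext z
  rw [← evAt_apply, ← evAt_apply]
  by_cases hz : z ∈ U
  · rw [map_mul, map_mul, evAt_wD_inr hU hρA hz, he z hz, one_mul]
  · rw [map_mul, evAt_apply z (wD hU i u), wD_apply_of_notMem hU _ _ hz, mul_zero]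

/-- Tangential derivatives of a function vanishing on `ρ = 0` vanish on `ρ = 0`. -/
theorem tang_eq_zero_of_eq_zero (hU : IsOpen U)
    (hρA : (ρA : CPt (n + 1) → ℂ) = fun w => ((ρ w : ℝ) : ℂ))
    (he : ∀ z ∈ U, evAt U z e * wzb m₀ (fun w => ((ρ w : ℝ) : ℂ)) z = 1)
    (hρ : ContDiffOn ℝ (⊤ : ℕ∞) ρ U) (hdρ : ∀ z ∈ U, fderiv ℝ ρ z ≠ 0)
    {O : Set (CPt (n + 1))} (hO : IsOpen O) {u : smoothOn U}
    (hu : ∀ z ∈ O, ρ z = 0 → evAt U z u = 0) (i : Fin (n + 1) ⊕ Fin (n + 1)) {z : CPt (n + 1)}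
    (hzU : z ∈ U) (hzO : z ∈ O) (hz : ρ z = 0) :
    evAt U z (tang (wD hU) e ρA (Sum.inr m₀) i u) = 0 := by
  have hρz := hρ.contDiffAt (hU.mem_nhds hzU)
  obtain ⟨c, hc⟩ := exists_fderiv_eq_smul hρz (hdρ z hzU)
    ((smoothOn.contDiffOn u).contDiffAt (hU.mem_nhds hzU)) (by
      filter_upwards [hO.mem_nhds hzO] with y hy hyz
      exact (hu y hy (hyz.trans hz)).trans (hu z hzO hz).symm)
  have hcD : ∀ i, evAt U z (wD hU i u) = c * evAt U z (wD hU i ρA) := by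
    intro i
    obtain ⟨a, b, s, hi⟩ := wd_eq i
    rw [evAt_apply, evAt_apply, wD_apply hU _ _ hzU, wD_apply hU _ _ hzU, hρA, hi, hi, hc, hc,
      fderiv_ofReal_comp (hρz.differentiableAt (by simp)),
      fderiv_ofReal_comp (hρz.differentiableAt (by simp))]
    ring
  have h0 := congrArg (evAt U z) (tang_self (mul_wD_pivot hU hρA he) i)
  simp only [tang_apply, map_sub, map_mul, map_zero] at h0
  simp only [tang_apply, map_sub, map_mul, hcD]
  linear_combination c * h0

/-- The coefficients of the CR vector fields `∂/∂z̄_l - (ρ_{z̄_l} / ρ_{z̄_{m₀}}) ∂/∂z̄_{m₀}`. -/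
def crCoeff (ρ : CPt (n + 1) → ℝ) (m₀ : Fin (n + 1)) (e : smoothOn U) (j : Fin n)
    (m : Fin (n + 1)) (z : CPt (n + 1)) : ℂ :=
  (Pi.single (m₀.succAbove j) 1 : Fin (n + 1) → ℂ) m -
    evAt U z e * wzb (m₀.succAbove j) (fun w => ((ρ w : ℝ) : ℂ)) z *
      (Pi.single m₀ 1 : Fin (n + 1) → ℂ) m

theorem eqOn_crOp_crCoeff (hU : IsOpen U)
    (hρA : (ρA : CPt (n + 1) → ℂ) = fun w => ((ρ w : ℝ) : ℂ)) (j : Fin n)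
    {u : CPt (n + 1) → ℂ} {v : smoothOn U} (h : Set.EqOn u v U) :
    Set.EqOn (crOp (crCoeff ρ m₀ e) j u)
      (tang (wD hU) e ρA (Sum.inr m₀) (Sum.inr (m₀.succAbove j)) v : smoothOn U) U := by
  intro z hz
  rw [← evAt_apply, tang_apply, map_sub, map_mul, map_mul]
  simp only [evAt_apply z (wD hU _ _)]
  rw [← wD_eqOn hU _ h hz, ← wD_eqOn hU _ h hz, wD_apply hU _ _ hz, hρA]
  simp [crOp, crCoeff, sub_mul, Finset.sum_sub_distrib, Pi.single_apply, mul_assoc, ite_mul, wd]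

theorem crBasisOn_crCoeff (hU : IsOpen U) {M : Set (CPt (n + 1))}
    (hρA : (ρA : CPt (n + 1) → ℂ) = fun w => ((ρ w : ℝ) : ℂ))
    (he : ∀ z ∈ U, evAt U z e * wzb m₀ (fun w => ((ρ w : ℝ) : ℂ)) z = 1) :
    CRBasisOn (n + 1) n M U ρ (crCoeff ρ m₀ e) := by
  refine ⟨fun j m => ?_, fun j z hz => ?_, fun z hz => ?_⟩
  · have h1 : ContDiffOn ℝ (⊤ : ℕ∞)
        (wzb (m₀.succAbove j) (fun w => ((ρ w : ℝ) : ℂ))) U := by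
      rw [← hρA]
      exact contDiffOn_wd hU (Sum.inr _) (smoothOn.contDiffOn ρA)
    exact contDiffOn_const.sub (((smoothOn.contDiffOn e).mul h1).mul contDiffOn_const)
  · have h1 := eqOn_crOp_crCoeff (e := e) (m₀ := m₀) hU hρA j (u := fun w => ((ρ w : ℝ) : ℂ))
      (v := ρA) (fun z _ => by rw [hρA]) hz.2
    rw [tang_self (mul_wD_pivot hU hρA he)] at h1
    exact h1
  · rw [Fintype.linearIndependent_iff]
    intro g hg k
    have := congrFun hg (m₀.succAbove k)
    simpa [crCoeff, Finset.sum_apply, Pi.single_apply, Fin.succAbove_ne] using this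

theorem crPow_crCoeff (hU : IsOpen U)
    (hρA : (ρA : CPt (n + 1) → ℂ) = fun w => ((ρ w : ℝ) : ℂ)) (α : Fin n → ℕ) (l : Fin (n + 1))
    {z : CPt (n + 1)} (hz : z ∈ U) :
    crPow (crCoeff ρ m₀ e) α (wz l fun w => ((ρ w : ℝ) : ℂ)) z =
      vecAt z (vecPow (fun j => tang (wD hU) e ρA (Sum.inr m₀) (Sum.inr (m₀.succAbove j)))
        (fun l => wD hU (Sum.inl l) ρA) α) l := by
  rw [vecAt, vecPow_apply, evAt_apply]
  refine dpow_rel (f := crOp (crCoeff ρ m₀ e)) (R := fun u (v : smoothOn U) => Set.EqOn u v U)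
    (fun j u v huv => eqOn_crOp_crCoeff hU hρA j huv) _ α ?_ hz
  exact wD_eqOn hU (Sum.inl l) fun z _ => by rw [hρA]

theorem spanCondAt_crCoeff_iff (hU : IsOpen U)
    (hρA : (ρA : CPt (n + 1) → ℂ) = fun w => ((ρ w : ℝ) : ℂ)) {z : CPt (n + 1)} (hz : z ∈ U)
    (k : ℕ) : SpanCondAt (n + 1) n ρ (crCoeff ρ m₀ e) k z ↔
      jetSpan (fun j => tang (wD hU) e ρA (Sum.inr m₀) (Sum.inr (m₀.succAbove j)))
        (fun l => wD hU (Sum.inl l) ρA) k z = ⊤ := by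
  rw [SpanCondAt, jetSpan]
  congr! 2
  ext v
  refine exists_congr fun α => and_congr_right fun _ => ?_
  rw [eq_comm]
  congr! 1
  exact funext fun l => crPow_crCoeff hU hρA α l hz

/-- Holomorphic nondegeneracy produces a determinant of CR derivatives of `ρ_z` with a
nonvanishing tangential derivative. -/
theorem exists_evAt_dpow_det_ne_zero (hU : IsOpen U) {M : Set (CPt (n + 1))} {p₀ : CPt (n + 1)}
    (hdef : DefiningFn (n + 1) M U ρ p₀) (hp₀ : p₀ ∈ M)
    (hρA : (ρA : CPt (n + 1) → ℂ) = fun w => ((ρ w : ℝ) : ℂ))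
    (he : ∀ z ∈ U, evAt U z e * wzb m₀ (fun w => ((ρ w : ℝ) : ℂ)) z = 1)
    (hnd : ¬ HoloDegenerateAt (n + 1) M p₀) :
    ∃ (α : Fin (n + 1) → Fin n → ℕ) (β : Fin (n + 1) → ℕ),
      evAt U p₀ (dpow (fun i => tang (wD hU) e ρA (Sum.inr m₀) (Sum.inl i))
        (List.finRange (n + 1)) β (Matrix.of fun k => vecPow
          (fun j => tang (wD hU) e ρA (Sum.inr m₀) (Sum.inr (m₀.succAbove j)))
            (fun l => wD hU (Sum.inl l) ρA) (α k)).det) ≠ 0 := by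
  have hp₀U : p₀ ∈ U := hdef.2.1
  set φ := cTaylorHom hU p₀ with hφ
  have hφD : ∀ i u, pderiv ℂ i (φ u) = φ (wD hU i u) := pderiv_cTaylorHom hU p₀
  have hφT : ∀ i u, φ (tang (wD hU) e ρA (Sum.inr m₀) i u) =
      tang (pderiv ℂ) (φ e) (φ ρA) (Sum.inr m₀) i (φ u) := by
    intro i u
    simp only [tang_apply, map_sub, map_mul, hφD]
  have h0 : constantCoeff (φ ρA) = 0 := by
    have : p₀ ∈ M ∩ U := ⟨hp₀, hp₀U⟩
    rw [hdef.2.2.2.1] at this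
    rw [constantCoeff_cTaylorHom, hρA]
    simpa using this.2
  have he1 : φ e * pderiv ℂ (Sum.inr m₀) (φ ρA) = 1 := by
    have h1 : Set.EqOn ((1 : smoothOn U) : CPt (n + 1) → ℂ)
        (e * wD hU (Sum.inr m₀) ρA : smoothOn U) U := fun z hz => by
      rw [← evAt_apply, ← evAt_apply, map_one, map_mul, evAt_wD_inr hU hρA hz, he z hz]
    rw [hφD, ← map_mul, ← cTaylor_eq hU hp₀U h1, cTaylor_eq hU hp₀U (Set.eqOn_refl _ U), map_one]
  obtain ⟨α, β, h⟩ := exists_det_tang_ne_zero h0 he1 (fun a ha => by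
    by_contra hne
    refine hnd ⟨U, ρ, hdef, a, Function.ne_iff.1 hne, ?_⟩
    rw [cTaylor_eq hU hp₀U (v := ρA) fun z _ => by rw [hρA]]
    convert ha using 3 with j
    rw [hφD]
    exact cTaylor_eq hU hp₀U (wD_eqOn hU (Sum.inl j) fun z _ => by rw [hρA]))
  refine ⟨α, β, fun h1 => h ?_⟩
  rw [evAt_apply, ← constantCoeff_cTaylorHom hU, ← hφ,
    dpow_semiconj φ (fun i u => hφT (Sum.inl i) u), RingHom.map_det] at h1
  convert h1 using 4
  ext k l
  simp only [Matrix.of_apply, RingHom.mapMatrix_apply, Matrix.map_apply, vecPow_apply]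
  rw [dpow_semiconj φ (fun i u => hφT (Sum.inr (m₀.succAbove i)) u), hφD]

end

/-- A square matrix whose rows lie in a proper subspace is singular. -/
theorem Matrix.det_eq_zero_of_rows_mem {K ι : Type*} [Field K] [Fintype ι] [DecidableEq ι]
    {B : Matrix ι ι K} {E : Submodule K (ι → K)} (hE : E ≠ ⊤) (hB : ∀ i, B i ∈ E) : B.det = 0 := by
  by_contra hdet
  have hli : LinearIndependent K B.row :=
    Matrix.linearIndependent_rows_iff_isUnit.2 ((B.isUnit_iff_isUnit_det).2 (Ne.isUnit hdet))
  refine hE (top_le_iff.1 ?_)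
  rw [← hli.span_eq_top_of_card_eq_finrank' (by simp), Submodule.span_le]
  rintro _ ⟨i, rfl⟩
  exact hB i

/-- Near a point of a hypersurface there is a defining function some fixed derivative
`∂ρ/∂z̄_m` of which has no zeros. -/
theorem exists_definingFn_wzb_ne_zero {N : ℕ} {M : Set (CPt N)} {p : CPt N}
    (h : ∃ U ρ, DefiningFn N M U ρ p) : ∃ U ρ m, DefiningFn N M U ρ p ∧
      ∀ z ∈ U, wzb m (fun w => ((ρ w : ℝ) : ℂ)) z ≠ 0 := by
  obtain ⟨U, ρ, hU, hpU, hρ, hMU, hdρ⟩ := h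
  obtain ⟨m, hm⟩ := exists_wzb_ne_zero
    ((hρ.contDiffAt (hU.mem_nhds hpU)).differentiableAt (by simp)) (hdρ p hpU)
  have hc : ContinuousOn (wzb m fun w => ((ρ w : ℝ) : ℂ)) U :=
    (contDiffOn_wd hU (Sum.inr m) (Complex.ofRealCLM.contDiff.comp_contDiffOn hρ)).continuousOn
  refine ⟨U ∩ (wzb m fun w => ((ρ w : ℝ) : ℂ)) ⁻¹' {0}ᶜ, ρ, m,
    ⟨hc.isOpen_inter_preimage hU isOpen_compl_singleton, ⟨hpU, hm⟩, hρ.mono Set.inter_subset_left,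
      ?_, fun z hz => hdρ z hz.1⟩, fun z hz => hz.2⟩
  rw [← Set.inter_assoc, hMU]
  ext z
  simp only [Set.mem_inter_iff, Set.mem_ofPred_eq]
  tauto

end

/-- Proposition 3.50.  If a smooth real hypersurface `M ⊂ ℂ^N` is
holomorphically nondegenerate at `p₀ ∈ M`, then there is an open neighborhood `U = M ∩ W`
of `p₀` in `M` and a dense open subset `U' = M ∩ W' ⊆ U` such that `M` is finitely
nondegenerate of order at most `N − 1` at every point of `U'`. -/
theorem statement17 (N : ℕ) (hN : 1 ≤ N) (M : Set (CPt N)) (hM : IsHypersurface N M)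
    (p₀ : CPt N) (hp₀ : p₀ ∈ M) (hnd : ¬ HoloDegenerateAt N M p₀) :
    ∃ W W' : Set (CPt N), IsOpen W ∧ p₀ ∈ W ∧ IsOpen W' ∧
      M ∩ W' ⊆ M ∩ W ∧ M ∩ W ⊆ closure (M ∩ W') ∧
      ∀ p ∈ M ∩ W', FinNondegOrderLe N (N - 1) M p := by
  obtain ⟨n, rfl⟩ : ∃ n, N = n + 1 := ⟨N - 1, by omega⟩
  obtain ⟨U, ρ, m₀, hdef, hm₀⟩ := exists_definingFn_wzb_ne_zero (hM p₀ hp₀)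
  obtain ⟨hU, hp₀U, hρ, hMU, hdρ⟩ := id hdef
  have hmem : ∀ {z}, z ∈ U → (z ∈ M ↔ ρ z = 0) := fun {z} hz => by
    simpa [hz] using Set.ext_iff.1 hMU z
  obtain ⟨ρA, hρA⟩ : ∃ ρA : smoothOn U, (ρA : CPt (n + 1) → ℂ) = fun w => ((ρ w : ℝ) : ℂ) :=
    ⟨⟨_, Complex.ofRealCLM.contDiff.comp_contDiffOn hρ⟩, rfl⟩
  obtain ⟨e, he⟩ : ∃ e : smoothOn U,
      ∀ z ∈ U, evAt U z e * wzb m₀ (fun w => ((ρ w : ℝ) : ℂ)) z = 1 := by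
    refine ⟨⟨fun z => (wzb m₀ (fun w => ((ρ w : ℝ) : ℂ)) z)⁻¹, ?_⟩,
      fun z hz => inv_mul_cancel₀ (hm₀ z hz)⟩
    have h := contDiffOn_wd hU (Sum.inr m₀) (smoothOn.contDiffOn ρA)
    rw [hρA] at h
    exact h.inv hm₀
  obtain ⟨α, β, hαβ⟩ := exists_evAt_dpow_det_ne_zero hU hdef hp₀ hρA he hnd
  set L : Fin n → Derivation ℂ (smoothOn U) (smoothOn U) :=
    fun j => tang (wD hU) e ρA (Sum.inr m₀) (Sum.inr (m₀.succAbove j)) with hL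
  set w : Fin (n + 1) → smoothOn U := fun l => wD hU (Sum.inl l) ρA with hw
  set Δ : smoothOn U := (Matrix.of fun k => vecPow L w (α k)).det with hΔ
  set Θ : smoothOn U := dpow (fun i => tang (wD hU) e ρA (Sum.inr m₀) (Sum.inl i))
    (List.finRange (n + 1)) β Δ with hΘ
  set W : Set (CPt (n + 1)) := U ∩ (Θ : CPt (n + 1) → ℂ) ⁻¹' {0}ᶜ with hW
  have hWo : IsOpen W :=
    (smoothOn.contDiffOn Θ).continuousOn.isOpen_inter_preimage hU isOpen_compl_singleton
  have hW'o : IsOpen (W ∩ {z | jetSpan L w n z = ⊤}) := by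
    refine isOpen_iff_eventually.2 fun z hz => ?_
    filter_upwards [hWo.mem_nhds hz.1, eventually_finrank_jetSpan_le (L := L) (w := w) hU hz.1.1 n]
      with y hy hle
    refine ⟨hy, Submodule.eq_top_of_finrank_eq (le_antisymm (Submodule.finrank_le _) ?_)⟩
    rwa [hz.2, finrank_top] at hle
  refine ⟨W, W ∩ {z | jetSpan L w n z = ⊤}, hWo, ⟨hp₀U, hαβ⟩, hW'o, fun z hz => ⟨hz.1, hz.2.1⟩,
    fun p hp => ?_, fun p hp => ?_⟩
  · refine mem_closure_iff.2 fun B hB hpB => ?_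
    by_contra hempty
    have hZρ : ∀ {z}, z ∈ M ∩ (W ∩ B) → ρ z = 0 := fun hz => (hmem hz.2.1.1).1 hz.1
    have hne : ∀ z ∈ M ∩ (W ∩ B), jetSpan L w n z ≠ ⊤ := fun z hz h =>
      hempty ⟨z, hz.2.2, hz.1, hz.2.1, h⟩
    have hvan : ∀ i (O : Set (CPt (n + 1))) (u : smoothOn U), IsOpen O →
        (∀ z ∈ M ∩ (W ∩ B) ∩ O, evAt U z u = 0) →
        ∀ z ∈ M ∩ (W ∩ B) ∩ O, evAt U z (tang (wD hU) e ρA (Sum.inr m₀) i u) = 0 :=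
      fun i O u hO hu z hz => tang_eq_zero_of_eq_zero hU hρA he hρ hdρ ((hWo.inter hB).inter hO)
        (fun y hy hy0 => hu y ⟨⟨(hmem hy.1.1.1).2 hy0, hy.1⟩, hy.2⟩) i hz.1.2.1.1 ⟨hz.1.2, hz.2⟩
          (hZρ hz.1)
    have hw0 : ∀ z ∈ M ∩ (W ∩ B), vecAt z w ≠ 0 := by
      intro z hz h
      have hzU : z ∈ U := hz.2.1.1
      refine hm₀ z hzU ?_
      have h0 := congrFun h m₀
      rw [vecAt, evAt_apply, hw, wD_apply hU _ _ hzU, hρA] at h0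
      rw [← star_eq_zero, ← wz_ofReal_eq_star_wzb
        ((hρ.contDiffAt (hU.mem_nhds hzU)).differentiableAt (by simp))]
      exact h0
    have hrank : ∀ z ∈ M ∩ (W ∩ B), Module.finrank ℂ (jetSpan L w n z) ≤ n := by
      intro z hz
      have := Submodule.finrank_lt (hne z hz)
      rw [Module.finrank_fin_fun] at this
      omega
    obtain ⟨O, hO, ⟨q, hq⟩, hmemO⟩ := exists_isOpen_vecAt_mem_jetSpan (Z := M ∩ (W ∩ B)) hU
      (fun z hz => hz.2.1.1) ⟨p, hp.1, hp.2, hpB⟩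
      (fun i j => tang_comm (mul_wD_pivot hU hρA he) (wD_comm hU) _ _) (fun j => hvan _) hw0 hrank
    have hΔ0 : ∀ z ∈ M ∩ (W ∩ B) ∩ O, evAt U z Δ = 0 := fun z hz => by
      rw [hΔ, AlgHom.map_det]
      exact Matrix.det_eq_zero_of_rows_mem (hne z hz.1) fun k => hmemO z hz (α k)
    exact hq.1.2.1.2 (dpow_induction
      (Q := fun u : smoothOn U => ∀ z ∈ M ∩ (W ∩ B) ∩ O, evAt U z u = 0)
      (fun i u hu => hvan (Sum.inl i) O u hO hu) (List.finRange (n + 1)) β hΔ0 q hq)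
  · exact ⟨U, ρ, crCoeff ρ m₀ e, ⟨hU, hp.2.1.1, hρ, hMU, hdρ⟩, crBasisOn_crCoeff hU hρA he,
      (spanCondAt_crCoeff_iff hU hρA hp.2.1.1 n).2 hp.2.2⟩
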